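/- Let Ω = B(0,1) ⊂ ℝⁿ, n ≥ 3. Let A be a (λ,Λ)-elliptic coefficient matrix, let B : Ω → ℝⁿ be a measurable drift with δ(x)^{1−β}|B(x)| ≤ M for all x ∈ Ω, and let G be a Green's function of L₁ = −div(A∇·) + B·∇ on Ω. Then there exists a constant K > 0, depending only on n, λ, Λ, M, β, such that for all y, z ∈ Ω with |z − y| ≤ δ(y)/2 one has G(y,z) ≥ K · |z − y|^{2−n}. -/

import Mathlib

open Set Metric MeasureTheory Filter
open scoped RealInnerProductSpace Topology

noncomputable section

/-- Euclidean space `ℝⁿ`. -/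
abbrev Euc (n : ℕ) := EuclideanSpace ℝ (Fin n)

/-- A `(λ, Λ)`-elliptic coefficient matrix on the unit ball:
`⟨A(x)η, η⟩ ≥ λ|η|²` and `|⟨A(x)η, ψ⟩| ≤ Λ|η||ψ|` for all `x ∈ Ω`, `η, ψ ∈ ℝⁿ`. -/
def IsElliptic {n : ℕ} (lam Lam : ℝ) (A : Euc n → Euc n →L[ℝ] Euc n) : Prop :=
  ∀ x ∈ ball (0 : Euc n) 1,
    (∀ η : Euc n, lam * ‖η‖ ^ 2 ≤ ⟪A x η, η⟫) ∧
      ∀ η ψ : Euc n, |⟪A x η, ψ⟫| ≤ Lam * ‖η‖ * ‖ψ‖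

/-- The drift bound `δ(x)^(1-β) |B(x)| ≤ M` on the unit ball, where `δ(x) = 1 - |x|`. -/
def DriftBound {n : ℕ} (β M : ℝ) (B : Euc n → Euc n) : Prop :=
  ∀ x ∈ ball (0 : Euc n) 1, (1 - ‖x‖) ^ (1 - β) * ‖B x‖ ≤ M

/-- A Green's function of `L₁ = -div(A∇·) + B·∇` on the unit ball `Ω = B(0,1)`:
`G > 0` off the diagonal, `G(y, ·)` is `C¹` away from `y` with `G(y,·)` and `|∇ₓG(y,·)|`
locally integrable on `Ω`, and
`∫_Ω (⟨A∇φ, ∇ₓG(y,·)⟩ - G(y,·)⟨B, ∇φ⟩) = φ(y)` for every `φ ∈ C_c^∞(Ω)`, `y ∈ Ω`. -/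
def IsGreenFn {n : ℕ} (A : Euc n → Euc n →L[ℝ] Euc n) (B : Euc n → Euc n)
    (G : Euc n → Euc n → ℝ) : Prop :=
  (∀ y ∈ ball (0 : Euc n) 1, ∀ x ∈ ball (0 : Euc n) 1, x ≠ y → 0 < G y x) ∧
  (∀ y ∈ ball (0 : Euc n) 1, ContDiffOn ℝ 1 (G y) (ball 0 1 \ {y})) ∧
  (∀ y ∈ ball (0 : Euc n) 1, LocallyIntegrableOn (G y) (ball 0 1)) ∧
  (∀ y ∈ ball (0 : Euc n) 1,
    LocallyIntegrableOn (fun x => ‖gradient (G y) x‖) (ball 0 1)) ∧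
  (∀ y ∈ ball (0 : Euc n) 1, ∀ φ : Euc n → ℝ,
    ContDiff ℝ (⊤ : ℕ∞) φ → HasCompactSupport φ → tsupport φ ⊆ ball 0 1 →
    (∫ x in ball (0 : Euc n) 1,
      (⟪A x (gradient φ x), gradient (G y) x⟫ - G y x * ⟪B x, gradient φ x⟫)) = φ y)

/-- A function whose topological support lies in an open set on which it is `C^k` is `C^k`. -/
theorem contDiff_of_tsupport_subset {E F : Type*} [NormedAddCommGroup E] [NormedSpace ℝ E]
    [NormedAddCommGroup F] [NormedSpace ℝ F] {U : Set E} (hU : IsOpen U) {k : WithTop ℕ∞}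
    {f : E → F} (hf : ContDiffOn ℝ k f U) (h : tsupport f ⊆ U) : ContDiff ℝ k f := by
  rw [contDiff_iff_contDiffAt]
  intro x
  by_cases hx : x ∈ U
  · exact hf.contDiffAt (hU.mem_nhds hx)
  · have hx' : x ∉ tsupport f := fun h' => hx (h h')
    exact contDiffAt_const.congr_of_eventuallyEq (notMem_tsupport_iff_eventuallyEq.1 hx')

theorem continuous_of_tsupport_subset {E F : Type*} [TopologicalSpace E]
    [TopologicalSpace F] [Zero F] {U : Set E} (hU : IsOpen U)
    {f : E → F} (hf : ContinuousOn f U) (h : tsupport f ⊆ U) : Continuous f := by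
  rw [continuous_iff_continuousAt]
  intro x
  by_cases hx : x ∈ U
  · exact hf.continuousAt (hU.mem_nhds hx)
  · have hx' : x ∉ tsupport f := fun h' => hx (h h')
    exact continuousAt_const.congr (notMem_tsupport_iff_eventuallyEq.1 hx').symm

theorem integrable_of_bounded_of_eq_zero {n : ℕ} {F : Type*} [NormedAddCommGroup F]
    {U K : Set (Euc n)} (hK : IsCompact K) (hKU : K ⊆ U) {h : Euc n → F}
    (hm : AEStronglyMeasurable h (volume.restrict U)) {C : ℝ} (hC : ∀ x ∈ K, ‖h x‖ ≤ C)
    (h0 : ∀ x ∉ K, h x = 0) : Integrable h := by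
  have : IntegrableOn h K := by
    refine IntegrableOn.of_bound hK.measure_lt_top
      (hm.mono_measure (Measure.restrict_mono hKU le_rfl)) C ?_
    exact (ae_restrict_iff' hK.measurableSet).2 (Eventually.of_forall hC)
  refine (integrableOn_iff_integrable_of_support_subset ?_).1 this
  intro x hx
  by_contra hxK
  exact hx (h0 x hxK)

/-- A weak equation that holds for smooth test functions also holds for `C¹` test functions. -/
theorem integral_fderiv_eq_zero_of_smooth {n : ℕ} {U : Set (Euc n)} (hU : IsOpen U)
    {F : Euc n → Euc n} (hF : ∀ K ⊆ U, IsCompact K → IntegrableOn F K)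
    (h : ∀ φ : Euc n → ℝ, ContDiff ℝ (⊤ : ℕ∞) φ → HasCompactSupport φ → tsupport φ ⊆ U →
      ∫ x, fderiv ℝ φ x (F x) = 0)
    {ψ : Euc n → ℝ} (hψ : ContDiff ℝ 1 ψ) (hψc : HasCompactSupport ψ) (hψU : tsupport ψ ⊆ U) :
    ∫ x, fderiv ℝ ψ x (F x) = 0 := by
  obtain ⟨δ, hδ, hδU⟩ := IsCompact.exists_cthickening_subset_open hψc hU hψU
  set K := cthickening δ (tsupport ψ) with hK
  have hKc : IsCompact K := hψc.isCompact.cthickening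
  have hFK := hF K hδU hKc
  have hDc : Continuous (fderiv ℝ ψ) := hψ.continuous_fderiv one_ne_zero
  have hDcs : HasCompactSupport (fderiv ℝ ψ) := hψc.fderiv (𝕜 := ℝ)
  have huc : UniformContinuous (fderiv ℝ ψ) := hDcs.uniformContinuous_of_continuous hDc
  have hint : ∀ {φ : Euc n → ℝ}, ContDiff ℝ 1 φ → tsupport φ ⊆ K →
      IntegrableOn (fun x => fderiv ℝ φ x (F x)) K ∧
      ∫ x, fderiv ℝ φ x (F x) = ∫ x in K, fderiv ℝ φ x (F x) := by
    intro φ hφ hφK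
    constructor
    · have hc : Continuous (fderiv ℝ φ) := hφ.continuous_fderiv one_ne_zero
      obtain ⟨C, hC⟩ := hKc.exists_bound_of_continuousOn hc.continuousOn
      refine Integrable.mono' (hFK.norm.const_mul C) ?_ ?_
      · exact ContinuousLinearMap.aestronglyMeasurable_comp₂
          (ContinuousLinearMap.id ℝ (Euc n →L[ℝ] ℝ)) hc.aestronglyMeasurable
          hFK.aestronglyMeasurable
      · refine (ae_restrict_iff' hKc.measurableSet).2 (Eventually.of_forall fun x hx => ?_)
        exact (ContinuousLinearMap.le_opNorm _ _).trans
          (mul_le_mul_of_nonneg_right (hC x hx) (norm_nonneg _))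
    · refine (setIntegral_eq_integral_of_forall_compl_eq_zero fun x hx => ?_).symm
      have : fderiv ℝ φ x = 0 := by
        by_contra h0
        exact hx (hφK (support_fderiv_subset ℝ h0))
      simp [this]
  have key : ∀ ε > 0, |∫ x, fderiv ℝ ψ x (F x)| ≤ ε * ∫ x in K, ‖F x‖ := by
    intro ε hε
    obtain ⟨d, hd, hdε⟩ := Metric.uniformContinuous_iff.1 huc ε hε
    let b : ContDiffBump (0 : Euc n) := ⟨min d δ / 2, min d δ, by positivity, by
      have : 0 < min d δ := lt_min hd hδ
      linarith⟩
    let L := ContinuousLinearMap.lsmul ℝ ℝ (E := ℝ)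
    set φ : Euc n → ℝ := convolution (b.normed volume) ψ L volume with hφ
    have hbl : LocallyIntegrable (b.normed volume) (volume : Measure (Euc n)) :=
      b.integrable_normed.locallyIntegrable
    have hφs : ContDiff ℝ (⊤ : ℕ∞) φ := by
      refine HasCompactSupport.contDiff_convolution_left _ b.hasCompactSupport_normed
        b.contDiff_normed ?_
      exact (hψ.continuous.integrable_of_hasCompactSupport hψc).locallyIntegrable
    have hφK : tsupport φ ⊆ K := by
      refine closure_minimal ?_ isClosed_cthickening
      refine (support_convolution_subset L).trans ?_
      rw [b.support_normed_eq]
      rintro _ ⟨a, ha, c, hc, rfl⟩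
      refine mem_cthickening_of_dist_le _ c _ _ (subset_tsupport _ hc) ?_
      have : dist a 0 < min d δ := ha
      simp only [dist_zero_right] at this
      simpa using (this.trans_le (min_le_right _ _)).le
    have hφc : HasCompactSupport φ := HasCompactSupport.of_support_subset_isCompact hKc
      ((subset_tsupport _).trans hφK)
    have hD : ∀ x, ‖fderiv ℝ φ x - fderiv ℝ ψ x‖ ≤ ε := by
      intro x
      have h1 := (hψc.hasFDerivAt_convolution_right L hbl hψ x).fderiv
      have h2 : convolution (b.normed volume) (fderiv ℝ ψ)
          (ContinuousLinearMap.precompR (Euc n) L) volume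
          = convolution (b.normed volume) (fderiv ℝ ψ)
            (ContinuousLinearMap.lsmul ℝ ℝ) volume := by
        ext1 y
        unfold convolution
        congr 1
      have h3 : fderiv ℝ φ x = _ := h1
      rw [h3, h2, ← dist_eq_norm]
      refine b.dist_normed_convolution_le hDc.aestronglyMeasurable fun y hy => ?_
      exact (hdε ((mem_ball.1 hy).trans_le (min_le_left _ _))).le
    have hz := h φ hφs hφc (hφK.trans hδU)
    obtain ⟨i1, e1⟩ := hint (hφs.of_le (by exact_mod_cast le_top)) hφK
    obtain ⟨i2, e2⟩ := hint hψ (self_subset_cthickening _)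
    rw [e1] at hz
    rw [e2, ← sub_zero (∫ x in K, _), ← hz, ← integral_sub i2 i1, ← integral_const_mul,
      ← Real.norm_eq_abs]
    refine norm_integral_le_of_norm_le (hFK.norm.const_mul ε) (Eventually.of_forall fun x => ?_)
    rw [← sub_apply]
    refine (ContinuousLinearMap.le_opNorm _ _).trans ?_
    rw [norm_sub_rev]
    exact mul_le_mul_of_nonneg_right (hD x) (norm_nonneg _)
  by_contra hne
  have hpos : 0 < |∫ x, fderiv ℝ ψ x (F x)| := abs_pos.2 hne
  have hI : 0 ≤ ∫ x in K, ‖F x‖ := integral_nonneg fun _ => norm_nonneg _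
  have := key (|∫ x, fderiv ℝ ψ x (F x)| / (2 * ((∫ x in K, ‖F x‖) + 1))) (by positivity)
  rw [div_mul_eq_mul_div, le_div_iff₀ (by positivity)] at this
  nlinarith

theorem exists_bound_deriv_smoothTransition :
    ∃ L > (0 : ℝ), ∀ t, |deriv Real.smoothTransition t| ≤ L := by
  have hc : Continuous (deriv Real.smoothTransition) :=
    (Real.smoothTransition.contDiff (n := 1)).continuous_deriv le_rfl
  obtain ⟨C, hC⟩ := isCompact_Icc.exists_bound_of_continuousOn
    (s := Icc (0 : ℝ) 1) hc.continuousOn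
  refine ⟨max C 1, by positivity, fun t => ?_⟩
  by_cases h : t ∈ Icc (0 : ℝ) 1
  · exact (hC t h).trans (le_max_left _ _)
  · have h0 : deriv Real.smoothTransition t = 0 := by
      rw [mem_Icc, not_and_or, not_le, not_le] at h
      rcases h with h | h
      · have : Real.smoothTransition =ᶠ[𝓝 t] fun _ => 0 := by
          filter_upwards [Iio_mem_nhds h] with s hs
          exact Real.smoothTransition.zero_of_nonpos (le_of_lt hs)
        rw [this.deriv_eq, deriv_const]
      · have : Real.smoothTransition =ᶠ[𝓝 t] fun _ => 1 := by
          filter_upwards [Ioi_mem_nhds h] with s hs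
          exact Real.smoothTransition.one_of_one_le (le_of_lt hs)
        rw [this.deriv_eq, deriv_const]
    rw [h0, abs_zero]
    positivity

theorem deriv_smoothTransition_of_neg {t : ℝ} (h : t < 0) :
    deriv Real.smoothTransition t = 0 := by
  have : Real.smoothTransition =ᶠ[𝓝 t] fun _ => 0 := by
    filter_upwards [Iio_mem_nhds h] with s hs
    exact Real.smoothTransition.zero_of_nonpos (le_of_lt hs)
  rw [this.deriv_eq, deriv_const]

/-- Smooth cutoff functions between concentric balls, with a gradient bound. -/
theorem exists_cutoff (n : ℕ) : ∃ L > (0 : ℝ), ∀ (x₀ : Euc n) (s r : ℝ), 0 < s → s < r →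
    ∃ η : Euc n → ℝ, ContDiff ℝ (⊤ : ℕ∞) η ∧ (∀ x, 0 ≤ η x) ∧ (∀ x, η x ≤ 1) ∧
      (∀ x ∈ closedBall x₀ s, η x = 1) ∧ tsupport η ⊆ closedBall x₀ r ∧
      ∀ x, ‖fderiv ℝ η x‖ ≤ L / (r - s) := by
  obtain ⟨L, hL, hLb⟩ := exists_bound_deriv_smoothTransition
  refine ⟨2 * L, by positivity, fun x₀ s r hs hsr => ?_⟩
  have hr : 0 < r := hs.trans hsr
  have hd : 0 < r ^ 2 - s ^ 2 := by nlinarith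
  set h : Euc n → ℝ := fun x => (r ^ 2 - ‖x - x₀‖ ^ 2) / (r ^ 2 - s ^ 2) with hh
  have hhs : ContDiff ℝ (⊤ : ℕ∞) h := by
    have := (contDiff_id.sub (contDiff_const (c := x₀))).norm_sq ℝ (E := Euc n) (n := (⊤ : ℕ∞))
    exact (contDiff_const.sub this).div_const _
  refine ⟨fun x => Real.smoothTransition (h x), ?_, ?_, ?_, ?_, ?_, ?_⟩
  · exact (Real.smoothTransition.contDiff (n := (⊤ : ℕ∞))).comp hhs
  · exact fun x => Real.smoothTransition.nonneg _
  · exact fun x => Real.smoothTransition.le_one _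
  · intro x hx
    refine Real.smoothTransition.one_of_one_le ?_
    rw [mem_closedBall, dist_eq_norm] at hx
    rw [hh, le_div_iff₀ hd]
    nlinarith [norm_nonneg (x - x₀)]
  · refine closure_minimal ?_ isClosed_closedBall
    intro x hx
    rw [mem_closedBall, dist_eq_norm]
    by_contra hlt
    push Not at hlt
    refine hx (Real.smoothTransition.zero_of_nonpos ?_)
    rw [hh]
    refine div_nonpos_of_nonpos_of_nonneg ?_ hd.le
    nlinarith
  · intro x
    have hD : HasFDerivAt h ((r ^ 2 - s ^ 2)⁻¹ • (-((2 : ℝ) • (innerSL ℝ (x - x₀) : Euc n →L[ℝ] ℝ)))) x := by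
      have h1 : HasFDerivAt (fun y : Euc n => ‖y - x₀‖ ^ 2) ((2 : ℝ) • (innerSL ℝ (x - x₀) : Euc n →L[ℝ] ℝ)) x := by
        have := ((hasFDerivAt_id x).sub_const x₀).norm_sq
        rw [ofNat_smul_eq_nsmul]
        simpa using this
      have h2 := ((h1.const_sub (r ^ 2)).const_smul (r ^ 2 - s ^ 2)⁻¹)
      refine h2.congr_of_eventuallyEq (Eventually.of_forall fun y => ?_)
      simp [hh, div_eq_inv_mul]
    have hg : HasDerivAt Real.smoothTransition (deriv Real.smoothTransition (h x)) (h x) :=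
      ((Real.smoothTransition.contDiff (n := 1)).differentiable one_ne_zero _).hasDerivAt
    have hc := (hg.comp_hasFDerivAt x hD).fderiv
    have hc' : fderiv ℝ (fun x => Real.smoothTransition (h x)) x = _ := hc
    rw [hc', norm_smul, norm_smul, norm_neg, norm_smul,
      innerSL_apply_norm]
    have hpos : 0 < r - s := by linarith
    by_cases hx : ‖x - x₀‖ ≤ r
    · calc _ ≤ L * (‖(r ^ 2 - s ^ 2)⁻¹‖ * (‖(2 : ℝ)‖ * r)) := by
            gcongr
            exact hLb _
        _ = 2 * L / (r - s) * (r / (r + s)) := by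
            rw [Real.norm_of_nonneg (inv_nonneg.2 hd.le)]
            have : r ^ 2 - s ^ 2 = (r - s) * (r + s) := by ring
            rw [this]
            simp
            field_simp
        _ ≤ 2 * L / (r - s) * 1 := by
            gcongr
            rw [div_le_one (by positivity)]
            linarith
        _ = _ := mul_one _
    · push Not at hx
      have : h x < 0 := by
        rw [hh]
        refine div_neg_of_neg_of_pos ?_ hd
        nlinarith
      rw [deriv_smoothTransition_of_neg this, norm_zero, zero_mul]
      positivity

/-- The Sobolev inequality for `C¹` functions with compact support, with exponent `2 * n / (n - 2)`. -/
theorem exists_sobolev_const {n : ℕ} (hn : 3 ≤ n) : ∃ C > (0 : ℝ), ∀ v : Euc n → ℝ,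
    ContDiff ℝ 1 v → HasCompactSupport v →
    (∫ x, |v x| ^ (2 / (((n : ℝ) - 2) / n))) ^ (((n : ℝ) - 2) / n)
      ≤ C * ∫ x, ‖fderiv ℝ v x‖ ^ 2 := by
  have hn' : (3 : ℝ) ≤ n := by exact_mod_cast hn
  set θ : ℝ := ((n : ℝ) - 2) / n with hθ
  have hθ0 : 0 < θ := div_pos (by linarith) (by linarith)
  obtain ⟨p', hp'⟩ : ∃ p' : NNReal, (p' : ℝ) = 2 / θ := ⟨⟨2 / θ, by positivity⟩, rfl⟩
  set S := SNormLESNormFDerivOfEqConst ℝ (volume : Measure (Euc n)) ((2 : NNReal) : ℝ) with hS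
  refine ⟨(S : ℝ) ^ 2 + 1, by positivity, fun v hv hvc => ?_⟩
  have key := eLpNorm_le_eLpNorm_fderiv_of_eq (volume : Measure (Euc n)) (F := ℝ) hv hvc
    (p := 2) (p' := p') (by norm_num) (by simp; omega) (by
      simp only [hp', finrank_euclideanSpace_fin, hθ]
      have : (n : ℝ) - 2 ≠ 0 := by linarith
      push_cast
      field_simp)
  have hDc : Continuous (fderiv ℝ v) := hv.continuous_fderiv one_ne_zero
  have hDcs : HasCompactSupport (fderiv ℝ v) := hvc.fderiv (𝕜 := ℝ)
  have m1 : MemLp v p' := hv.continuous.memLp_of_hasCompactSupport hvc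
  have m2 : MemLp (fderiv ℝ v) (2 : NNReal) (volume : Measure (Euc n)) :=
    hDc.memLp_of_hasCompactSupport hDcs
  have hp'0 : (p' : ENNReal) ≠ 0 := by
    have : p' ≠ 0 := by
      intro h0
      have : (2 / θ : ℝ) = 0 := by rw [← hp', h0, NNReal.coe_zero]
      have : (0 : ℝ) < 2 / θ := by positivity
      linarith
    exact_mod_cast this
  rw [m1.eLpNorm_eq_integral_rpow_norm hp'0 ENNReal.coe_ne_top,
    m2.eLpNorm_eq_integral_rpow_norm (by norm_num) ENNReal.coe_ne_top,
    ← ENNReal.ofReal_coe_nnreal (p := SNormLESNormFDerivOfEqConst ℝ _ _),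
    ← ENNReal.ofReal_mul (NNReal.coe_nonneg _)] at key
  have hI : 0 ≤ ∫ x, ‖fderiv ℝ v x‖ ^ 2 := integral_nonneg fun _ => by positivity
  have hJ : 0 ≤ ∫ x, |v x| ^ (2 / θ) := integral_nonneg fun _ => by positivity
  rw [ENNReal.ofReal_le_ofReal_iff (by positivity)] at key
  have e1 : ((p' : ENNReal).toReal) = 2 / θ := hp'
  have e2 : (((2 : NNReal) : ENNReal).toReal) = 2 := by simp
  rw [e1, e2] at key
  simp only [Real.rpow_two, Real.norm_eq_abs] at key
  have k2 := pow_le_pow_left₀ (by positivity) key 2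
  rw [mul_pow] at k2
  have e3 : ((∫ x, |v x| ^ (2 / θ)) ^ (2 / θ)⁻¹) ^ 2 = (∫ x, |v x| ^ (2 / θ)) ^ θ := by
    rw [← Real.rpow_natCast, ← Real.rpow_mul hJ]
    congr 1
    push_cast
    field_simp
  have e4 : ((∫ x, ‖fderiv ℝ v x‖ ^ 2) ^ (2 : ℝ)⁻¹) ^ 2 = ∫ x, ‖fderiv ℝ v x‖ ^ 2 := by
    rw [← Real.rpow_natCast, ← Real.rpow_mul hI]
    norm_num
  rw [e3, e4] at k2
  refine k2.trans ?_
  gcongr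
  linarith

theorem lintegral_comp_smul_add {n : ℕ} {g : Euc n → ENNReal} (hg : Measurable g) {a : ℝ}
    (ha : 0 < a) (c : Euc n) :
    ∫⁻ x, g (a • x + c) = ENNReal.ofReal ((a ^ n)⁻¹) * ∫⁻ x, g x := by
  have h1 : ∫⁻ x : Euc n, g (a • x + c) = ∫⁻ x, g (x + c) ∂(Measure.map (a • ·) volume) := by
    rw [lintegral_map (f := fun x => g (x + c)) (hg.comp (measurable_add_const c))
      (measurable_const_smul a)]
  rw [h1, Measure.map_addHaar_smul _ ha.ne', lintegral_smul_measure,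
    lintegral_add_right_eq_self, finrank_euclideanSpace_fin, abs_of_pos (by positivity)]
  rfl

/-- An `L¹` Poincaré inequality on unit balls, relative to the value at a suitable point. -/
theorem exists_poincare {n : ℕ} (x₀ : Euc n) {w : Euc n → ℝ} {U : Set (Euc n)} (hU : IsOpen U)
    (hw : ContDiffOn ℝ 1 w U) (hBU : closedBall x₀ 1 ⊆ U) :
    ∃ y ∈ ball x₀ 1, ∫ x in ball x₀ 1, |w x - w y|
      ≤ 2 * 2 ^ n * ∫ x in ball x₀ 1, ‖fderiv ℝ w x‖ := by
  set B := ball x₀ (1 : ℝ) with hB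
  have hBU' : B ⊆ U := ball_subset_closedBall.trans hBU
  have hBm : MeasurableSet B := measurableSet_ball
  have hwc : ContinuousOn w U := hw.continuousOn
  have hDc : ContinuousOn (fderiv ℝ w) U := hw.continuousOn_fderiv_of_isOpen hU le_rfl
  have hBv : volume B ≠ 0 := (measure_ball_pos _ _ one_pos).ne'
  have hBf : volume B ≠ ⊤ := measure_ball_lt_top.ne
  set g : Euc n → ENNReal := B.indicator fun x => ‖fderiv ℝ w x‖ₑ with hg
  have hgm : Measurable g := by
    have : Measurable (B.indicator (fderiv ℝ w)) :=
      (measurable_fderiv ℝ w).indicator hBm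
    have h2 : g = fun x => ‖B.indicator (fderiv ℝ w) x‖ₑ := by
      ext x
      by_cases hx : x ∈ B
      · simp [hg, hx]
      · rw [hg, indicator_of_notMem hx, indicator_of_notMem hx]
        exact (enorm_zero (E := Euc n →L[ℝ] ℝ)).symm
    rw [h2]
    exact this.enorm
  have hDint : IntegrableOn (fun x => ‖fderiv ℝ w x‖) B :=
    ((hDc.norm.mono hBU).integrableOn_compact (isCompact_closedBall x₀ 1)).mono_set
      ball_subset_closedBall
  set I : ENNReal := ∫⁻ x, g x with hI
  have hIB : I = ∫⁻ x in B, ‖fderiv ℝ w x‖ₑ := lintegral_indicator hBm _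
  have hIr : I = ENNReal.ofReal (∫ x in B, ‖fderiv ℝ w x‖) := by
    rw [hIB, ofReal_integral_eq_lintegral_ofReal hDint (Eventually.of_forall fun _ => norm_nonneg _)]
    simp
  have hseg : ∀ x ∈ B, ∀ y ∈ B, ‖w x - w y‖ₑ ≤
      2 * ∫⁻ t in Icc (0 : ℝ) 1, g ((1 - t) • x + t • y) := by
    intro x hx y hy
    have hmem : ∀ t ∈ Icc (0 : ℝ) 1, (1 - t) • x + t • y ∈ B := fun t ht =>
      (convex_ball x₀ 1) hx hy (by linarith [ht.2]) ht.1 (by ring)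
    have hder : ∀ t ∈ uIcc (0 : ℝ) 1, HasDerivAt (fun t : ℝ => w ((1 - t) • x + t • y))
        (fderiv ℝ w ((1 - t) • x + t • y) (y - x)) t := by
      intro t ht
      rw [uIcc_of_le zero_le_one] at ht
      have h1 : HasDerivAt (fun t : ℝ => (1 - t) • x + t • y) (y - x) t := by
        have a1 := ((hasDerivAt_id t).const_sub 1).smul_const x
        have a2 := (hasDerivAt_id t).smul_const y
        convert! a1.add a2 using 1
        simp only [neg_smul, one_smul]
        abel
      have h2 : DifferentiableAt ℝ w ((1 - t) • x + t • y) :=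
        (hw.differentiableOn one_ne_zero).differentiableAt (hU.mem_nhds (hBU' (hmem t ht)))
      exact h2.hasFDerivAt.comp_hasDerivAt t h1
    have hcont : ContinuousOn (fun t : ℝ => fderiv ℝ w ((1 - t) • x + t • y) (y - x))
        (uIcc 0 1) := by
      rw [uIcc_of_le zero_le_one]
      refine ContinuousOn.clm_apply (hDc.comp (by fun_prop) fun t ht => hBU' (hmem t ht))
        continuousOn_const
    have hftc := intervalIntegral.integral_eq_sub_of_hasDerivAt hder hcont.intervalIntegrable
    simp only [sub_zero, one_smul, zero_smul, add_zero, sub_self, zero_add] at hftc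
    rw [← enorm_neg, neg_sub, ← hftc, intervalIntegral.integral_of_le zero_le_one,
      ← integral_Icc_eq_integral_Ioc]
    refine (enorm_integral_le_lintegral_enorm _).trans ?_
    rw [← lintegral_const_mul' _ _ (by simp)]
    refine setLIntegral_mono' measurableSet_Icc fun t ht => ?_
    have hgt : g ((1 - t) • x + t • y) = ‖fderiv ℝ w ((1 - t) • x + t • y)‖ₑ :=
      indicator_of_mem (hmem t ht) _
    rw [hgt, mul_comm]
    refine (ContinuousLinearMap.le_opENorm _ _).trans ?_
    gcongr
    have : ‖y - x‖ ≤ 2 := by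
      have hx' : dist x x₀ < 1 := hx
      have hy' : dist y x₀ < 1 := hy
      rw [← dist_eq_norm]
      linarith [dist_triangle_right y x x₀]
    rw [← ofReal_norm]
    exact (ENNReal.ofReal_le_ofReal this).trans (by simp)
  have hT : ∀ t ∈ Icc (0 : ℝ) 1, ∫⁻ y in B, ∫⁻ x in B, g ((1 - t) • x + t • y)
      ≤ 2 ^ n * I * volume B := by
    intro t ht
    have hpow : ∀ a : ℝ, 1 / 2 ≤ a → ENNReal.ofReal ((a ^ n)⁻¹) ≤ 2 ^ n := by
      intro a ha
      have : (a ^ n)⁻¹ ≤ 2 ^ n := by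
        rw [← inv_pow]
        have : a⁻¹ ≤ 2 := by
          rw [inv_le_comm₀ (by linarith) (by norm_num)]
          linarith
        exact pow_le_pow_left₀ (by positivity) this n
      refine (ENNReal.ofReal_le_ofReal this).trans ?_
      rw [ENNReal.ofReal_pow (by norm_num)]
      simp
    rcases le_total t (1 / 2) with h | h
    · calc ∫⁻ y in B, ∫⁻ x in B, g ((1 - t) • x + t • y)
          ≤ ∫⁻ y in B, 2 ^ n * I := by
            gcongr with y
            refine (setLIntegral_le_lintegral _ _).trans ?_
            rw [lintegral_comp_smul_add hgm (by linarith)]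
            gcongr
            exact hpow _ (by linarith)
        _ = _ := by rw [setLIntegral_const]
    · rw [lintegral_lintegral_swap]
      · calc ∫⁻ x in B, ∫⁻ y in B, g ((1 - t) • x + t • y)
            ≤ ∫⁻ x in B, 2 ^ n * I := by
              gcongr with x
              refine (setLIntegral_le_lintegral _ _).trans ?_
              simp_rw [add_comm ((1 - t) • x)]
              rw [lintegral_comp_smul_add hgm (by linarith)]
              gcongr
              exact hpow _ (by linarith)
          _ = _ := by rw [setLIntegral_const]
      · exact (hgm.comp (by fun_prop)).aemeasurable
  set J : Euc n → ENNReal := fun y =>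
    ∫⁻ x in B, ∫⁻ t in Icc (0 : ℝ) 1, g ((1 - t) • x + t • y) with hJdef
  have hJm : Measurable J := by
    have h1 : Measurable fun p : (Euc n × Euc n) × ℝ =>
        g ((1 - p.2) • p.1.2 + p.2 • p.1.1) := hgm.comp (by fun_prop)
    have h2 : Measurable fun p : Euc n × Euc n =>
        ∫⁻ t in Icc (0 : ℝ) 1, g ((1 - t) • p.2 + t • p.1) := h1.lintegral_prod_right'
    exact h2.lintegral_prod_right'
  have hJ : ∫⁻ y in B, J y ≤ 2 ^ n * I * volume B := by
    calc ∫⁻ y in B, J y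
        = ∫⁻ t in Icc (0 : ℝ) 1, ∫⁻ y in B, ∫⁻ x in B, g ((1 - t) • x + t • y) := by
          have h0 : ∀ y, J y = ∫⁻ t in Icc (0 : ℝ) 1, ∫⁻ x in B, g ((1 - t) • x + t • y) := by
            intro y
            refine lintegral_lintegral_swap (Measurable.aemeasurable ?_)
            exact hgm.comp (f := fun p : Euc n × ℝ => (1 - p.2) • p.1 + p.2 • y) (by fun_prop)
          simp_rw [h0]
          refine lintegral_lintegral_swap ?_
          have : Measurable fun p : (Euc n × ℝ) × Euc n =>
              g ((1 - p.1.2) • p.2 + p.1.2 • p.1.1) := hgm.comp (by fun_prop)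
          exact this.lintegral_prod_right'.aemeasurable
      _ ≤ ∫⁻ t in Icc (0 : ℝ) 1, 2 ^ n * I * volume B :=
          setLIntegral_mono' measurableSet_Icc hT
      _ = _ := by simp
  obtain ⟨y, hy, hyle⟩ := exists_le_setLAverage hBv hBf hJm.aemeasurable (μ := volume)
  refine ⟨y, hy, ?_⟩
  have h1 : ∫⁻ x in B, ‖w x - w y‖ₑ ≤ 2 * 2 ^ n * I := by
    calc ∫⁻ x in B, ‖w x - w y‖ₑ
        ≤ ∫⁻ x in B, 2 * ∫⁻ t in Icc (0 : ℝ) 1, g ((1 - t) • x + t • y) :=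
          setLIntegral_mono' hBm fun x hx => hseg x hx y hy
      _ = 2 * J y := lintegral_const_mul' 2 _ (by simp)
      _ ≤ 2 * (2 ^ n * I) := by
          gcongr
          refine hyle.trans ?_
          rw [setLAverage_eq]
          exact ENNReal.div_le_of_le_mul hJ
      _ = _ := by ring
  rw [integral_eq_lintegral_of_nonneg_ae (Eventually.of_forall fun _ => abs_nonneg _)]
  · refine ENNReal.toReal_le_of_le_ofReal (by positivity) ?_
    calc _ = ∫⁻ x in B, ‖w x - w y‖ₑ := by
          simp [Real.enorm_eq_ofReal_abs]
      _ ≤ 2 * 2 ^ n * I := h1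
      _ = _ := by
          rw [hIr, ENNReal.ofReal_mul (by positivity), ENNReal.ofReal_mul (by positivity),
            ENNReal.ofReal_pow (by norm_num), ENNReal.ofReal_ofNat]
  · exact ((hwc.mono hBU').sub continuousOn_const).abs.aestronglyMeasurable hBm

/-- `w = log u` for a positive `C¹` weak solution `u` of a divergence form equation
`div F = 0` with flux `F = u f`, where `f` has the structure of `Aᵀ∇w - B`. -/
structure IsLogSol {n : ℕ} (lam Lam b : ℝ) (U : Set (Euc n)) (w : Euc n → ℝ)
    (f : Euc n → Euc n) : Prop where
  isOpen : IsOpen U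
  contDiffOn : ContDiffOn ℝ 1 w U
  aestronglyMeasurable : AEStronglyMeasurable f (volume.restrict U)
  coercive : ∀ x ∈ U, lam * ‖fderiv ℝ w x‖ ^ 2 - b * ‖fderiv ℝ w x‖ ≤ fderiv ℝ w x (f x)
  bound : ∀ x ∈ U, ‖f x‖ ≤ Lam * ‖fderiv ℝ w x‖ + b
  weak : ∀ ψ : Euc n → ℝ, ContDiff ℝ 1 ψ → HasCompactSupport ψ → tsupport ψ ⊆ U →
    ∫ x, (fderiv ℝ ψ x (f x) - ψ x * fderiv ℝ w x (f x)) = 0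

theorem IsLogSol.sub_const {n : ℕ} {lam Lam b : ℝ} {U : Set (Euc n)} {w : Euc n → ℝ}
    {f : Euc n → Euc n} (h : IsLogSol lam Lam b U w f) (c : ℝ) :
    IsLogSol lam Lam b U (fun x => w x - c) f where
  isOpen := h.isOpen
  contDiffOn := h.contDiffOn.sub contDiffOn_const
  aestronglyMeasurable := h.aestronglyMeasurable
  coercive x hx := by simpa only [fderiv_sub_const] using h.coercive x hx
  bound x hx := by simpa only [fderiv_sub_const] using h.bound x hx
  weak ψ h1 h2 h3 := by simpa only [fderiv_sub_const] using h.weak ψ h1 h2 h3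

theorem coercive_algebra {lam Lam b κ d X Y η T N : ℝ} (hlam : 0 < lam)
    (hκ : 0 < κ) (hd : κ ≤ d) (hη : 0 ≤ η)
    (hT : lam * X ^ 2 - b * X ≤ T) (hN : |N| ≤ Y * (Lam * X + b)) :
    d * (lam / 2 * (η ^ 2 * X ^ 2)
      - (1 / lam + 4 * Lam ^ 2 / (κ ^ 2 * lam) + 1 / κ) * (b ^ 2 * η ^ 2 + Y ^ 2))
      ≤ d * η ^ 2 * T - 2 * η * |N| := by
  have hd0 : 0 < d := hκ.trans_le hd
  have h1 : b * X ≤ lam * X ^ 2 / 4 + b ^ 2 / lam := by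
    have : 0 ≤ (lam * X / 2 - b) ^ 2 / lam := by positivity
    have e : (lam * X / 2 - b) ^ 2 / lam = lam * X ^ 2 / 4 + b ^ 2 / lam - b * X := by
      field_simp
      ring
    linarith
  have h2 : 2 * η * (Y * (Lam * X)) ≤
      d * (lam / 4 * (η ^ 2 * X ^ 2) + 4 * Lam ^ 2 / (κ ^ 2 * lam) * Y ^ 2) := by
    have : 0 ≤ d * lam * (η * X / 2 - 2 * (Lam * Y) / (d * lam)) ^ 2 := by positivity
    have e : d * lam * (η * X / 2 - 2 * (Lam * Y) / (d * lam)) ^ 2 =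
        d * (lam / 4 * (η ^ 2 * X ^ 2)) + 4 * Lam ^ 2 / (d * lam) * Y ^ 2
          - 2 * η * (Y * (Lam * X)) := by
      field_simp
      ring
    have h3 : 4 * Lam ^ 2 / (d * lam) * Y ^ 2 ≤ d * (4 * Lam ^ 2 / (κ ^ 2 * lam) * Y ^ 2) := by
      have e2 : 4 * Lam ^ 2 / (d * lam) * Y ^ 2 =
          d * (4 * Lam ^ 2 / (d ^ 2 * lam) * Y ^ 2) := by
        field_simp
      rw [e2]
      gcongr
    linarith
  have h4 : 2 * η * (Y * b) ≤ d * (1 / κ * (b ^ 2 * η ^ 2 + Y ^ 2)) := by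
    have a1 : 2 * η * (Y * b) ≤ b ^ 2 * η ^ 2 + Y ^ 2 := by nlinarith [sq_nonneg (b * η - Y)]
    have a2 : 1 ≤ d * (1 / κ) := by
      rw [mul_one_div, le_div_iff₀ hκ]
      linarith
    have a3 : 0 ≤ b ^ 2 * η ^ 2 + Y ^ 2 := by positivity
    nlinarith
  have h5 : 2 * η * |N| ≤ 2 * η * (Y * (Lam * X + b)) := by gcongr
  have h6 : d * η ^ 2 * (lam * X ^ 2 - b * X) ≤ d * η ^ 2 * T := by gcongr
  have h7 : d * η ^ 2 * (b * X) ≤ d * η ^ 2 * (lam * X ^ 2 / 4 + b ^ 2 / lam) := by gcongr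
  have h8 : 0 ≤ d * (1 / lam * Y ^ 2) := by positivity
  have h9 : 0 ≤ d * (4 * Lam ^ 2 / (κ ^ 2 * lam) * (b ^ 2 * η ^ 2)) := by positivity
  have e3 : b ^ 2 / lam = 1 / lam * b ^ 2 := by ring
  rw [e3] at h7
  nlinarith

theorem exists_caccioppoli {lam Lam κ : ℝ} (hlam : 0 < lam) (hκ : 0 < κ) :
    ∃ C > (0 : ℝ), ∀ (n : ℕ) (b : ℝ) (U : Set (Euc n)) (w : Euc n → ℝ)
      (f : Euc n → Euc n), IsLogSol lam Lam b U w f → ∀ q : ℝ, κ ≤ |q - 1| →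
      ∀ η : Euc n → ℝ, ContDiff ℝ 1 η → (∀ x, 0 ≤ η x) → HasCompactSupport η →
        tsupport η ⊆ U →
        ∫ x, Real.exp (q * w x) * (η x ^ 2 * ‖fderiv ℝ w x‖ ^ 2)
          ≤ C * ∫ x, Real.exp (q * w x) * (b ^ 2 * η x ^ 2 + ‖fderiv ℝ η x‖ ^ 2) := by
  set C₀ := 1 / lam + 4 * Lam ^ 2 / (κ ^ 2 * lam) + 1 / κ with hC₀
  have hC₀p : 0 < C₀ := by positivity
  refine ⟨2 / lam * C₀, by positivity, fun n b U w f hw q hq η hη hη0 hηc hηU => ?_⟩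
  have hU := hw.isOpen
  set E : Euc n → ℝ := fun x => Real.exp (q * w x) with hE
  have hEc : ContDiffOn ℝ 1 E U := (contDiffOn_const.mul hw.contDiffOn).exp
  have hDw : ContinuousOn (fderiv ℝ w) U := hw.contDiffOn.continuousOn_fderiv_of_isOpen hU le_rfl
  have hDη : Continuous (fderiv ℝ η) := hη.continuous_fderiv one_ne_zero
  have hd0 : 0 < |q - 1| := hκ.trans_le hq
  -- zero outside the support
  have hη_out : ∀ x ∉ tsupport η, η x = 0 := fun x hx => image_eq_zero_of_notMem_tsupport hx
  have hDη_out : ∀ x ∉ tsupport η, fderiv ℝ η x = 0 := fun x hx => by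
    by_contra h0
    exact hx (support_fderiv_subset ℝ h0)
  have hint : ∀ g : Euc n → ℝ, ContinuousOn g U → (∀ x ∉ tsupport η, g x = 0) → Integrable g := by
    intro g hg h0
    have hsub : tsupport g ⊆ tsupport η := by
      refine closure_minimal (fun x hx => ?_) (isClosed_tsupport _)
      by_contra hx'
      exact hx (h0 x hx')
    exact (continuous_of_tsupport_subset hU hg (hsub.trans hηU)).integrable_of_hasCompactSupport
      (HasCompactSupport.of_support_subset_isCompact hηc ((subset_tsupport _).trans hsub))
  have i1 : Integrable fun x => E x * (η x ^ 2 * ‖fderiv ℝ w x‖ ^ 2) := by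
    refine hint _ (hEc.continuousOn.mul (((hη.continuous.pow 2).continuousOn).mul
      (hDw.norm.pow 2))) fun x hx => ?_
    simp [hη_out x hx]
  have i2 : Integrable fun x => E x * (b ^ 2 * η x ^ 2 + ‖fderiv ℝ η x‖ ^ 2) := by
    refine hint _ (hEc.continuousOn.mul (((continuous_const.mul (hη.continuous.pow 2)).add (hDη.norm.pow 2)).continuousOn))
      fun x hx => ?_
    simp [hη_out x hx, hDη_out x hx]
  -- the test function
  set ψ : Euc n → ℝ := fun x => η x ^ 2 * E x with hψ
  have hψsub : tsupport ψ ⊆ tsupport η := by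
    refine closure_minimal (fun x hx => ?_) (isClosed_tsupport _)
    by_contra hx'
    exact hx (by simp [hψ, hη_out x hx'])
  have hψ1 : ContDiff ℝ 1 ψ := contDiff_of_tsupport_subset hU
    ((hη.pow 2).contDiffOn.mul hEc) (hψsub.trans hηU)
  have hψc : HasCompactSupport ψ :=
    HasCompactSupport.of_support_subset_isCompact hηc ((subset_tsupport _).trans hψsub)
  have hweak := hw.weak ψ hψ1 hψc (hψsub.trans hηU)
  have hform : ∀ x, fderiv ℝ ψ x (f x) - ψ x * fderiv ℝ w x (f x)
      = E x * ((q - 1) * η x ^ 2 * fderiv ℝ w x (f x) + 2 * η x * fderiv ℝ η x (f x)) := by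
    intro x
    by_cases hx : x ∈ U
    · have d1 : HasFDerivAt w (fderiv ℝ w x) x :=
        ((hw.contDiffOn.differentiableOn one_ne_zero).differentiableAt (hU.mem_nhds hx)).hasFDerivAt
      have d2 : HasFDerivAt η (fderiv ℝ η x) x := (hη.differentiable one_ne_zero x).hasFDerivAt
      have d3 := (d2.pow 2).mul ((d1.const_mul q).exp)
      have d4 : fderiv ℝ ψ x = _ := d3.fderiv
      rw [d4]
      simp [hψ, hE]
      ring
    · have hx' : x ∉ tsupport η := fun h => hx (hηU h)
      have hx'' : x ∉ tsupport ψ := fun h => hx' (hψsub h)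
      have h0 : fderiv ℝ ψ x = 0 := by
        by_contra h0
        exact hx'' (support_fderiv_subset ℝ h0)
      rw [h0]
      simp [hη_out x hx', hψ]
  have i3 : Integrable fun x => fderiv ℝ ψ x (f x) - ψ x * fderiv ℝ w x (f x) := by
    have hDψ : Continuous (fderiv ℝ ψ) := hψ1.continuous_fderiv one_ne_zero
    have hcont : ContinuousOn (fun x => fderiv ℝ ψ x - ψ x • fderiv ℝ w x) U :=
      hDψ.continuousOn.sub (hψ1.continuous.continuousOn.smul hDw)
    have hK := hηc.isCompact
    obtain ⟨C1, hC1⟩ := hK.exists_bound_of_continuousOn (hcont.mono hηU)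
    obtain ⟨C2, hC2⟩ := hK.exists_bound_of_continuousOn
      ((((continuousOn_const (c := Lam)).mul hDw.norm).add
        (continuousOn_const (c := b))).mono hηU)
    refine integrable_of_bounded_of_eq_zero hK hηU (C := C1 * C2) ?_ ?_ ?_
    · have := ContinuousLinearMap.aestronglyMeasurable_comp₂
          (ContinuousLinearMap.id ℝ (Euc n →L[ℝ] ℝ))
          (hcont.aestronglyMeasurable hU.measurableSet (μ := volume))
          hw.aestronglyMeasurable
      simpa using this
    · intro x hx
      have := ContinuousLinearMap.le_opNorm (fderiv ℝ ψ x - ψ x • fderiv ℝ w x) (f x)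
      have e : (fderiv ℝ ψ x - ψ x • fderiv ℝ w x) (f x)
        = fderiv ℝ ψ x (f x) - ψ x * fderiv ℝ w x (f x) := by simp
      rw [e] at this
      refine this.trans (mul_le_mul (hC1 x hx) ?_ (norm_nonneg _) ((norm_nonneg _).trans (hC1 x hx)))
      exact (hw.bound x (hηU hx)).trans ((le_abs_self _).trans (hC2 x hx))
    · intro x hx
      rw [hform]
      simp [hη_out x hx]
  have hpt : ∀ x, |q - 1| * (lam / 2 * (E x * (η x ^ 2 * ‖fderiv ℝ w x‖ ^ 2))
      - C₀ * (E x * (b ^ 2 * η x ^ 2 + ‖fderiv ℝ η x‖ ^ 2)))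
      ≤ SignType.sign (q - 1) * (fderiv ℝ ψ x (f x) - ψ x * fderiv ℝ w x (f x)) := by
    intro x
    by_cases hx : x ∈ U
    · have halg := coercive_algebra (Lam := Lam) (N := fderiv ℝ η x (f x))
        (Y := ‖fderiv ℝ η x‖) hlam hκ hq (hη0 x) (hw.coercive x hx)
        (by
          rw [← Real.norm_eq_abs]
          exact (ContinuousLinearMap.le_opNorm _ _).trans
            (mul_le_mul_of_nonneg_left (hw.bound x hx) (norm_nonneg _)))
      have hs : -|fderiv ℝ η x (f x)| ≤ SignType.sign (q - 1) * fderiv ℝ η x (f x) := by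
        rcases lt_or_gt_of_ne (abs_pos.1 hd0) with h | h
        · simp [sign_neg h]
          exact le_abs_self _
        · simp [sign_pos h]
          exact neg_abs_le _
      have e1 : |q - 1| = SignType.sign (q - 1) * (q - 1) := (sign_mul_self (q - 1)).symm
      rw [hform]
      have hE0 : 0 ≤ E x := (Real.exp_pos _).le
      have h3 := mul_le_mul_of_nonneg_left hs (mul_nonneg zero_le_two (hη0 x))
      calc _ = E x * (|q - 1| * (lam / 2 * (η x ^ 2 * ‖fderiv ℝ w x‖ ^ 2)
              - C₀ * (b ^ 2 * η x ^ 2 + ‖fderiv ℝ η x‖ ^ 2))) := by ring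
        _ ≤ E x * (|q - 1| * η x ^ 2 * fderiv ℝ w x (f x)
              + 2 * η x * (SignType.sign (q - 1) * fderiv ℝ η x (f x))) := by
            refine mul_le_mul_of_nonneg_left ?_ hE0
            linarith
        _ = _ := by
            nth_rewrite 1 [e1]
            ring
    · have hx' : x ∉ tsupport η := fun h => hx (hηU h)
      rw [hform]
      simp [hη_out x hx', hDη_out x hx']
  have hmono := integral_mono (((i1.const_mul (lam / 2)).sub (i2.const_mul C₀)).const_mul |q - 1|)
    (i3.const_mul (SignType.sign (q - 1) : ℝ)) hpt
  simp only [Pi.sub_apply] at hmono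
  rw [integral_const_mul, integral_const_mul, hweak, mul_zero,
    integral_sub (i1.const_mul _) (i2.const_mul _), integral_const_mul, integral_const_mul] at hmono
  have h1 := nonpos_of_mul_nonpos_right hmono hd0
  calc ∫ x, E x * (η x ^ 2 * ‖fderiv ℝ w x‖ ^ 2)
      = 2 / lam * (lam / 2 * ∫ x, E x * (η x ^ 2 * ‖fderiv ℝ w x‖ ^ 2)) := by
        field_simp
    _ ≤ 2 / lam * (C₀ * ∫ x, E x * (b ^ 2 * η x ^ 2 + ‖fderiv ℝ η x‖ ^ 2)) := by
        refine mul_le_mul_of_nonneg_left ?_ (by positivity)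
        linarith
    _ = _ := by ring

theorem integrable_of_continuousOn_of_eq_zero {n : ℕ} {U K : Set (Euc n)} {g : Euc n → ℝ}
    (hU : IsOpen U) (hK : IsCompact K) (hKU : K ⊆ U) (hg : ContinuousOn g U)
    (h0 : ∀ x ∉ K, g x = 0) : Integrable g := by
  obtain ⟨C, hC⟩ := hK.exists_bound_of_continuousOn (hg.mono hKU)
  exact integrable_of_bounded_of_eq_zero hK hKU
    (hg.aestronglyMeasurable hU.measurableSet) hC h0

theorem exists_moser_step {n : ℕ} (hn : 3 ≤ n) {lam : ℝ} (Lam : ℝ) {κ : ℝ} (b : ℝ)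
    (hlam : 0 < lam) (hκ : 0 < κ) :
    ∃ C > (0 : ℝ), ∀ (U : Set (Euc n)) (w : Euc n → ℝ) (f : Euc n → Euc n),
      IsLogSol lam Lam b U w f → ∀ x₀ : Euc n, closedBall x₀ 1 ⊆ U →
      ∀ q : ℝ, κ ≤ |q - 1| → ∀ s r : ℝ, 0 < s → s < r → r ≤ 1 →
      (∫ x in closedBall x₀ s, Real.exp (q / (((n : ℝ) - 2) / n) * w x)) ^ (((n : ℝ) - 2) / n)
        ≤ C * (1 + q ^ 2) / (r - s) ^ 2 * ∫ x in closedBall x₀ r, Real.exp (q * w x) := by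
  obtain ⟨C₁, hC₁, hcac⟩ := exists_caccioppoli (Lam := Lam) hlam hκ
  obtain ⟨C₂, hC₂, hsob⟩ := exists_sobolev_const hn
  obtain ⟨L, hL, hcut⟩ := exists_cutoff n
  have hθ : 0 < ((n : ℝ) - 2) / n := by
    have : (3 : ℝ) ≤ n := by exact_mod_cast hn
    exact div_pos (by linarith) (by linarith)
  set θ : ℝ := ((n : ℝ) - 2) / n
  refine ⟨C₂ * ((2 + C₁) * (b ^ 2 + L ^ 2)), by positivity,
    fun U w f hw x₀ hx₀ q hq s r hs hsr hr => ?_⟩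
  obtain ⟨η, hη, hη0, hη1, hηs, hηsupp, hDη⟩ := hcut x₀ s r hs hsr
  have hη' : ContDiff ℝ 1 η := hη.of_le (by exact_mod_cast le_top)
  have hU := hw.isOpen
  have hrU : closedBall x₀ r ⊆ U := (closedBall_subset_closedBall hr).trans hx₀
  have hηU : tsupport η ⊆ U := hηsupp.trans hrU
  have hηc : HasCompactSupport η :=
    HasCompactSupport.of_support_subset_isCompact (isCompact_closedBall x₀ r)
      ((subset_tsupport _).trans hηsupp)
  have hη_out : ∀ x ∉ tsupport η, η x = 0 := fun x hx => image_eq_zero_of_notMem_tsupport hx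
  have hDη_out : ∀ x ∉ tsupport η, fderiv ℝ η x = 0 := fun x hx => by
    by_contra h0
    exact hx (support_fderiv_subset ℝ h0)
  have hDw : ContinuousOn (fderiv ℝ w) U := hw.contDiffOn.continuousOn_fderiv_of_isOpen hU le_rfl
  have hDηc : Continuous (fderiv ℝ η) := hη'.continuous_fderiv one_ne_zero
  set E : Euc n → ℝ := fun x => Real.exp (q * w x) with hE
  have hEc : ContinuousOn E U := (continuousOn_const.mul hw.contDiffOn.continuousOn).rexp
  set g₁ : Euc n → ℝ := fun x => E x * (η x ^ 2 * ‖fderiv ℝ w x‖ ^ 2) with hg₁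
  set g₂ : Euc n → ℝ := fun x => E x * (b ^ 2 * η x ^ 2 + ‖fderiv ℝ η x‖ ^ 2) with hg₂
  have i1 : Integrable g₁ :=
    integrable_of_continuousOn_of_eq_zero hU hηc.isCompact hηU
      (hEc.mul (((hη.continuous.pow 2).continuousOn).mul (hDw.norm.pow 2)))
      fun x hx => by simp [hg₁, hη_out x hx]
  have hg₂c : ContinuousOn g₂ U := hEc.mul
    (((continuous_const.mul (hη.continuous.pow 2)).add (hDηc.norm.pow 2)).continuousOn)
  have i2 : Integrable g₂ :=
    integrable_of_continuousOn_of_eq_zero hU hηc.isCompact hηU hg₂c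
      fun x hx => by simp [hg₂, hη_out x hx, hDη_out x hx]
  have hg₁₂ : ∫ x, g₁ x ≤ C₁ * ∫ x, g₂ x := hcac n b U w f hw q hq η hη' hη0 hηc hηU
  have hg₂b : ∫ x, g₂ x ≤ (b ^ 2 + L ^ 2) / (r - s) ^ 2 * ∫ x in closedBall x₀ r, E x := by
    have hEi : IntegrableOn E (closedBall x₀ r) :=
      (hEc.mono hrU).integrableOn_compact (isCompact_closedBall _ _)
    rw [← integral_const_mul, ← integral_indicator isClosed_closedBall.measurableSet]
    refine integral_mono i2 (IntegrableOn.integrable_indicator (hEi.const_mul _)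
      isClosed_closedBall.measurableSet) fun x => ?_
    by_cases hx : x ∈ closedBall x₀ r
    · rw [indicator_of_mem hx]
      have a1 : η x ^ 2 ≤ 1 := pow_le_one₀ (hη0 x) (hη1 x)
      have a2 : ‖fderiv ℝ η x‖ ^ 2 ≤ (L / (r - s)) ^ 2 :=
        pow_le_pow_left₀ (norm_nonneg _) (hDη x) 2
      have a3 : 1 ≤ 1 / (r - s) ^ 2 := by
        rw [le_div_iff₀ (by nlinarith)]
        nlinarith
      have a4 : b ^ 2 * η x ^ 2 ≤ b ^ 2 * (1 / (r - s) ^ 2) :=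
        mul_le_mul_of_nonneg_left (a1.trans a3) (sq_nonneg b)
      have : b ^ 2 * η x ^ 2 + ‖fderiv ℝ η x‖ ^ 2 ≤ (b ^ 2 + L ^ 2) / (r - s) ^ 2 := by
        have e : (b ^ 2 + L ^ 2) / (r - s) ^ 2
          = b ^ 2 * (1 / (r - s) ^ 2) + (L / (r - s)) ^ 2 := by
          rw [div_pow]
          ring
        rw [e]
        linarith
      rw [mul_comm]
      exact mul_le_mul_of_nonneg_left this (Real.exp_pos _).le
    · rw [indicator_of_notMem hx]
      have hx' : x ∉ tsupport η := fun h => hx (hηsupp h)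
      simp [hg₂, hη_out x hx', hDη_out x hx']
  set v : Euc n → ℝ := fun x => η x * Real.exp (q / 2 * w x) with hv
  have hvsub : tsupport v ⊆ tsupport η := by
    refine closure_minimal (fun x hx => ?_) (isClosed_tsupport _)
    by_contra hx'
    exact hx (by simp [hv, hη_out x hx'])
  have hv1 : ContDiff ℝ 1 v := contDiff_of_tsupport_subset hU
    (hη'.contDiffOn.mul (contDiffOn_const.mul hw.contDiffOn).exp) (hvsub.trans hηU)
  have hvc : HasCompactSupport v :=
    HasCompactSupport.of_support_subset_isCompact hηc ((subset_tsupport _).trans hvsub)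
  have hS := hsob v hv1 hvc
  have hDv : ∀ x, ‖fderiv ℝ v x‖ ^ 2 ≤ 2 * g₂ x + q ^ 2 / 2 * g₁ x := by
    intro x
    by_cases hx : x ∈ U
    · have d1 : HasFDerivAt w (fderiv ℝ w x) x :=
        ((hw.contDiffOn.differentiableOn one_ne_zero).differentiableAt (hU.mem_nhds hx)).hasFDerivAt
      have d2 : HasFDerivAt η (fderiv ℝ η x) x := (hη'.differentiable one_ne_zero x).hasFDerivAt
      have d4 : fderiv ℝ v x = _ := (d2.mul ((d1.const_mul (q / 2)).exp)).fderiv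
      have d5 : fderiv ℝ v x = Real.exp (q / 2 * w x) •
          (fderiv ℝ η x + (q / 2 * η x) • fderiv ℝ w x) := by
        rw [d4]
        ext z
        simp
        ring
      have hexp : Real.exp (q / 2 * w x) ^ 2 = E x := by
        rw [hE, ← Real.exp_nat_mul]
        congr 1
        push_cast
        ring
      rw [d5, norm_smul, mul_pow, Real.norm_eq_abs, sq_abs, hexp]
      have h1 : ‖fderiv ℝ η x + (q / 2 * η x) • fderiv ℝ w x‖
          ≤ ‖fderiv ℝ η x‖ + |q / 2 * η x| * ‖fderiv ℝ w x‖ := by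
        refine (norm_add_le _ _).trans ?_
        rw [norm_smul, Real.norm_eq_abs]
      have h2 := pow_le_pow_left₀ (norm_nonneg _) h1 2
      have h3 : (|q / 2 * η x| * ‖fderiv ℝ w x‖) ^ 2
          = q ^ 2 / 4 * (η x ^ 2 * ‖fderiv ℝ w x‖ ^ 2) := by
        rw [mul_pow, sq_abs]
        ring
      have h4 : (‖fderiv ℝ η x‖ + |q / 2 * η x| * ‖fderiv ℝ w x‖) ^ 2
          ≤ 2 * ‖fderiv ℝ η x‖ ^ 2 + 2 * (|q / 2 * η x| * ‖fderiv ℝ w x‖) ^ 2 :=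
        add_sq_le.trans (by linarith)
      have h5 : 0 ≤ b ^ 2 * η x ^ 2 := by positivity
      calc E x * ‖fderiv ℝ η x + (q / 2 * η x) • fderiv ℝ w x‖ ^ 2
          ≤ E x * (2 * (b ^ 2 * η x ^ 2 + ‖fderiv ℝ η x‖ ^ 2)
            + q ^ 2 / 2 * (η x ^ 2 * ‖fderiv ℝ w x‖ ^ 2)) := by
            refine mul_le_mul_of_nonneg_left ?_ (Real.exp_pos _).le
            linarith
        _ = _ := by
            simp only [hg₁, hg₂]
            ring
    · have hx' : x ∉ tsupport v := fun h => hx (hηU (hvsub h))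
      have h0 : fderiv ℝ v x = 0 := by
        by_contra h0
        exact hx' (support_fderiv_subset ℝ h0)
      rw [h0, norm_zero, zero_pow two_ne_zero]
      have h1 : 0 ≤ g₁ x := mul_nonneg (Real.exp_pos _).le (by positivity)
      have h2 : 0 ≤ g₂ x := mul_nonneg (Real.exp_pos _).le (by positivity)
      positivity
  have hDvi : ∫ x, ‖fderiv ℝ v x‖ ^ 2 ≤ 2 * (∫ x, g₂ x) + q ^ 2 / 2 * ∫ x, g₁ x := by
    rw [← integral_const_mul, ← integral_const_mul,
      ← integral_add (i2.const_mul _) (i1.const_mul _)]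
    refine integral_mono_of_nonneg (Eventually.of_forall fun x => sq_nonneg _)
      ((i2.const_mul _).add (i1.const_mul _)) (Eventually.of_forall hDv)
  have hleft : ∫ x in closedBall x₀ s, Real.exp (q / θ * w x) ≤ ∫ x, |v x| ^ (2 / θ) := by
    have hvi : Integrable fun x => |v x| ^ (2 / θ) := by
      refine (hv1.continuous.abs.rpow_const fun x => Or.inr (by positivity)
        ).integrable_of_hasCompactSupport ?_
      refine HasCompactSupport.of_support_subset_isCompact hvc fun x hx => ?_
      by_contra hx'
      exact hx (by simp [image_eq_zero_of_notMem_tsupport hx', hθ.ne'])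
    refine le_trans (le_of_eq ?_) (setIntegral_le_integral (s := closedBall x₀ s) hvi
      (Eventually.of_forall fun x => by positivity))
    refine setIntegral_congr_fun isClosed_closedBall.measurableSet fun x hx => ?_
    simp only [hv]
    rw [hηs x hx, one_mul, abs_of_pos (Real.exp_pos _), ← Real.exp_mul]
    congr 1
    field_simp
  have h0 : 0 ≤ ∫ x in closedBall x₀ s, Real.exp (q / θ * w x) :=
    integral_nonneg fun x => (Real.exp_pos _).le
  have hI : 0 ≤ ∫ x in closedBall x₀ r, E x := integral_nonneg fun x => (Real.exp_pos _).le
  have hg₂0 : 0 ≤ ∫ x, g₂ x :=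
    integral_nonneg fun x => mul_nonneg (Real.exp_pos _).le (by positivity)
  calc _ ≤ (∫ x, |v x| ^ (2 / θ)) ^ θ := Real.rpow_le_rpow h0 hleft hθ.le
    _ ≤ C₂ * ∫ x, ‖fderiv ℝ v x‖ ^ 2 := hS
    _ ≤ C₂ * ((2 + C₁) * (1 + q ^ 2) * ∫ x, g₂ x) := by
        refine mul_le_mul_of_nonneg_left ?_ hC₂.le
        have h1 : q ^ 2 / 2 * ∫ x, g₁ x ≤ q ^ 2 / 2 * (C₁ * ∫ x, g₂ x) :=
          mul_le_mul_of_nonneg_left hg₁₂ (by positivity)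
        have h2 : 0 ≤ (q ^ 2 / 2 * C₁ + C₁ + 2 * q ^ 2) * ∫ x, g₂ x := by positivity
        linarith
    _ ≤ C₂ * ((2 + C₁) * (1 + q ^ 2) *
          ((b ^ 2 + L ^ 2) / (r - s) ^ 2 * ∫ x in closedBall x₀ r, E x)) := by
        gcongr
    _ = _ := by ring

theorem iterate_le {θ A D : ℝ} {N : ℕ → ℝ} (hθ0 : 0 < θ) (hθ1 : θ < 1) (hA : 1 ≤ A) (hD : 1 ≤ D)
    (hN : ∀ k, 0 ≤ N k) (h : ∀ k : ℕ, N (k + 1) ≤ (A * D ^ k) ^ (θ ^ k) * N k) (k : ℕ) :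
    N k ≤ A ^ (1 / (1 - θ)) * D ^ (∑' j : ℕ, (j : ℝ) * θ ^ j) * N 0 := by
  have hA0 : 0 < A := by linarith
  have hD0 : 0 < D := by linarith
  have key : ∀ k : ℕ, N k ≤ A ^ (∑ j ∈ Finset.range k, θ ^ j)
      * D ^ (∑ j ∈ Finset.range k, (j : ℝ) * θ ^ j) * N 0 := by
    intro k
    induction k with
    | zero => simp
    | succ k ih =>
      refine (h k).trans ?_
      have h1 : (A * D ^ k) ^ (θ ^ k) = A ^ (θ ^ k) * D ^ ((k : ℝ) * θ ^ k) := by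
        rw [Real.mul_rpow hA0.le (by positivity), ← Real.rpow_natCast D k, ← Real.rpow_mul hD0.le]
      rw [Finset.sum_range_succ, Finset.sum_range_succ, Real.rpow_add hA0, Real.rpow_add hD0, h1]
      calc _ ≤ A ^ (θ ^ k) * D ^ ((k : ℝ) * θ ^ k) * (A ^ (∑ j ∈ Finset.range k, θ ^ j)
            * D ^ (∑ j ∈ Finset.range k, (j : ℝ) * θ ^ j) * N 0) := by
            gcongr
        _ = _ := by ring
  refine (key k).trans ?_
  have s1 : ∑ j ∈ Finset.range k, θ ^ j ≤ 1 / (1 - θ) := by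
    rw [one_div, ← tsum_geometric_of_lt_one hθ0.le hθ1]
    exact (summable_geometric_of_lt_one hθ0.le hθ1).sum_le_tsum _ fun j _ => by positivity
  have s2 : ∑ j ∈ Finset.range k, (j : ℝ) * θ ^ j ≤ ∑' j : ℕ, (j : ℝ) * θ ^ j := by
    have : Summable fun j : ℕ => (j : ℝ) * θ ^ j := by
      simpa using summable_pow_mul_geometric_of_norm_lt_one (R := ℝ) 1
        (by rwa [Real.norm_of_nonneg hθ0.le] : ‖θ‖ < 1)
    exact this.sum_le_tsum _ fun j _ => by positivity
  have h0 := hN 0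
  gcongr

/-- Local boundedness of exponentials of logarithms of solutions, by Moser iteration. -/
theorem exists_sup_estimate {n : ℕ} (hn : 3 ≤ n) {lam : ℝ} (Lam : ℝ) {κ : ℝ} (b : ℝ)
    (hlam : 0 < lam) (hκ : 0 < κ) :
    ∃ C > (0 : ℝ), ∀ (U : Set (Euc n)) (w : Euc n → ℝ) (f : Euc n → Euc n),
      IsLogSol lam Lam b U w f → ∀ x₀ : Euc n, closedBall x₀ 1 ⊆ U →
      ∀ p : ℝ, |p| ≤ 1 → (∀ k : ℕ, κ ≤ |p / (((n : ℝ) - 2) / n) ^ k - 1|) →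
      ∀ s r : ℝ, 0 < s → s < r → r ≤ 1 → ∀ x ∈ ball x₀ s,
      Real.exp (p * w x) ≤ C / (r - s) ^ n * ∫ x in closedBall x₀ r, Real.exp (p * w x) := by
  obtain ⟨C₁, hC₁, hstep⟩ := exists_moser_step hn Lam b hlam hκ
  have hn' : (3 : ℝ) ≤ n := by exact_mod_cast hn
  have hθ0 : 0 < ((n : ℝ) - 2) / n := div_pos (by linarith) (by linarith)
  have hθ1 : ((n : ℝ) - 2) / n < 1 := by
    rw [div_lt_one (by linarith)]
    linarith
  have hθn : 1 / (1 - ((n : ℝ) - 2) / n) = n / 2 := by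
    field_simp
    ring
  set θ : ℝ := ((n : ℝ) - 2) / n
  set C₂ := max 1 (8 * C₁) with hC₂
  have hC₂1 : 1 ≤ C₂ := le_max_left _ _
  set D : ℝ := 4 / θ ^ 2 with hD
  have hD1 : 1 ≤ D := by
    rw [hD, le_div_iff₀ (by positivity)]
    nlinarith
  refine ⟨C₂ ^ ((n : ℝ) / 2) * D ^ (∑' j : ℕ, (j : ℝ) * θ ^ j), by positivity,
    fun U w f hw x₀ hx₀ p hp hpκ s r hs hsr hr x hx => ?_⟩
  have hd : 0 < r - s := by linarith
  set σ : ℕ → ℝ := fun k => s + (r - s) / 2 ^ k with hσ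
  set I : ℕ → ℝ := fun k => ∫ x in closedBall x₀ (σ k), Real.exp (p / θ ^ k * w x) with hI
  have hI0 : ∀ k, 0 ≤ I k := fun k => integral_nonneg fun x => (Real.exp_pos _).le
  have hwc : ContinuousOn w U := hw.contDiffOn.continuousOn
  have hσr : ∀ k, σ k ≤ r := fun k => by
    have : (r - s) / 2 ^ k ≤ r - s := div_le_self hd.le (one_le_pow₀ one_le_two)
    simp only [hσ]
    linarith
  have hσs : ∀ k, s < σ k := fun k => by
    have : 0 < (r - s) / 2 ^ k := by positivity
    simp only [hσ]
    linarith
  have hEi : ∀ (q t : ℝ), t ≤ r → IntegrableOn (fun x => Real.exp (q * w x)) (closedBall x₀ t) :=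
    fun q t ht => (((continuousOn_const.mul hwc).rexp).mono
      ((closedBall_subset_closedBall (ht.trans hr)).trans hx₀)).integrableOn_compact
      (isCompact_closedBall _ _)
  set A : ℝ := C₂ / (r - s) ^ 2 with hA
  have hA1 : 1 ≤ A := by
    rw [hA, le_div_iff₀ (by positivity)]
    nlinarith
  have hrec : ∀ k, I (k + 1) ^ (θ ^ (k + 1)) ≤ (A * D ^ k) ^ (θ ^ k) * I k ^ (θ ^ k) := by
    intro k
    have h1 := hstep U w f hw x₀ hx₀ (p / θ ^ k) (hpκ k) (σ (k + 1)) (σ k) (hs.trans (hσs _))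
      (by
        simp only [hσ]
        gcongr
        · norm_num
        · exact Nat.lt_succ_self k) ((hσr k).trans hr)
    have e1 : p / θ ^ k / θ = p / θ ^ (k + 1) := by
      rw [pow_succ, div_div]
    rw [e1] at h1
    have h2 : C₁ * (1 + (p / θ ^ k) ^ 2) / (σ k - σ (k + 1)) ^ 2 ≤ A * D ^ k := by
      have e2 : σ k - σ (k + 1) = (r - s) / (2 * 2 ^ k) := by
        simp only [hσ, pow_succ]
        field_simp
        ring
      have hp2 : p ^ 2 ≤ 1 := (sq_le_one_iff_abs_le_one p).2 hp
      have h3 : 1 + (p / θ ^ k) ^ 2 ≤ 2 * (1 / θ ^ k) ^ 2 := by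
        have : 1 ≤ (1 / θ ^ k) ^ 2 := by
          refine one_le_pow₀ ?_
          rw [le_div_iff₀ (by positivity), one_mul]
          exact pow_le_one₀ hθ0.le hθ1.le
        have e3 : (p / θ ^ k) ^ 2 = p ^ 2 * (1 / θ ^ k) ^ 2 := by ring
        rw [e3]
        nlinarith
      have e4 : D ^ k = (2 ^ k) ^ 2 * (1 / θ ^ k) ^ 2 := by
        rw [hD, div_pow, ← pow_mul, ← pow_mul, one_div, inv_pow, ← pow_mul, mul_comm k 2,
          pow_mul 2 2 k, div_eq_mul_inv]
        norm_num
      rw [e2, e4, hA]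
      calc _ ≤ C₁ * (2 * (1 / θ ^ k) ^ 2) / ((r - s) / (2 * 2 ^ k)) ^ 2 := by gcongr
        _ = 8 * C₁ / (r - s) ^ 2 * ((2 ^ k) ^ 2 * (1 / θ ^ k) ^ 2) := by
            field_simp
            ring
        _ ≤ _ := by
            have : 8 * C₁ ≤ C₂ := le_max_right _ _
            gcongr
    have h4 : I (k + 1) ^ θ ≤ A * D ^ k * I k :=
      h1.trans (mul_le_mul_of_nonneg_right h2 (hI0 k))
    rw [pow_succ', Real.rpow_mul (hI0 _), ← Real.mul_rpow (by positivity) (hI0 k)]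
    exact Real.rpow_le_rpow (Real.rpow_nonneg (hI0 _) _) h4 (by positivity)
  have hbound := iterate_le (N := fun k => I k ^ (θ ^ k)) hθ0 hθ1 hA1 hD1
    (fun k => Real.rpow_nonneg (hI0 k) _) hrec
  set R := A ^ (1 / (1 - θ)) * D ^ (∑' j : ℕ, (j : ℝ) * θ ^ j) * I 0 ^ (θ ^ 0) with hR
  have hRe : R = C₂ ^ ((n : ℝ) / 2) * D ^ (∑' j : ℕ, (j : ℝ) * θ ^ j) / (r - s) ^ n
      * ∫ x in closedBall x₀ r, Real.exp (p * w x) := by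
    have e1 : I 0 ^ (θ ^ 0) = ∫ x in closedBall x₀ r, Real.exp (p * w x) := by
      simp [hI, hσ]
    have e2 : A ^ (1 / (1 - θ)) = C₂ ^ ((n : ℝ) / 2) / (r - s) ^ n := by
      rw [hθn, hA, Real.div_rpow (by positivity) (by positivity), ← Real.rpow_natCast (r - s) 2,
        ← Real.rpow_mul hd.le, ← Real.rpow_natCast (r - s) n]
      congr 2
      push_cast
      ring
    rw [hR, e1, e2]
    ring
  rw [← hRe]
  refine le_of_forall_lt fun T hT => ?_
  obtain ⟨T', hTT', hT'⟩ := exists_between hT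
  rcases le_or_gt T' 0 with h0 | h0
  · refine hTT'.trans_le (h0.trans ?_)
    exact (Real.rpow_nonneg (hI0 0) _).trans (hbound 0)
  refine hTT'.trans_le ?_
  have hxU : x ∈ U := hx₀ (closedBall_subset_closedBall (hsr.le.trans hr) (ball_subset_closedBall hx))
  have hev : ∀ᶠ z in 𝓝 x, T' < Real.exp (p * w z) ∧ z ∈ ball x₀ s :=
    ((((continuousOn_const.mul hwc).rexp).continuousAt (hw.isOpen.mem_nhds hxU)).eventually
      (lt_mem_nhds hT')).and (isOpen_ball.mem_nhds hx)
  obtain ⟨ε, hε, hball⟩ := Metric.eventually_nhds_iff_ball.1 hev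
  set V := volume.real (ball x ε) with hV
  have hVpos : 0 < V := by
    rw [hV, measureReal_def]
    exact ENNReal.toReal_pos (measure_ball_pos volume x hε).ne' measure_ball_lt_top.ne
  have hlow : ∀ k, T' * V ^ (θ ^ k) ≤ R := by
    intro k
    refine le_trans ?_ (hbound k)
    have h1 : T' ^ (1 / θ ^ k) * V ≤ I k := by
      calc T' ^ (1 / θ ^ k) * V = ∫ z in ball x ε, T' ^ (1 / θ ^ k) := by
            rw [setIntegral_const, smul_eq_mul, mul_comm]
        _ ≤ ∫ z in ball x ε, Real.exp (p / θ ^ k * w z) := by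
            refine setIntegral_mono_on (integrableOn_const measure_ball_lt_top.ne)
              ((hEi (p / θ ^ k) (σ k) (hσr k)).mono_set ?_) measurableSet_ball ?_
            · exact fun z hz => closedBall_subset_closedBall (hσs k).le
                (ball_subset_closedBall (hball z hz).2)
            · intro z hz
              have := Real.rpow_le_rpow h0.le (hball z hz).1.le
                (by positivity : 0 ≤ 1 / θ ^ k)
              rw [← Real.exp_mul] at this
              refine this.trans (le_of_eq ?_)
              congr 1
              ring
        _ ≤ I k := by
            refine setIntegral_mono_set (hEi (p / θ ^ k) (σ k) (hσr k))
              (Eventually.of_forall fun z => (Real.exp_pos _).le)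
              (LE.le.eventuallyLE ?_)
            exact fun z hz => closedBall_subset_closedBall (hσs k).le
                (ball_subset_closedBall (hball z hz).2)
    have h2 := Real.rpow_le_rpow (by positivity) h1 (by positivity : 0 ≤ θ ^ k)
    rwa [Real.mul_rpow (by positivity) hVpos.le, ← Real.rpow_mul h0.le, one_div,
      inv_mul_cancel₀ (by positivity), Real.rpow_one] at h2
  have hlim : Tendsto (fun k : ℕ => T' * V ^ (θ ^ k)) atTop (𝓝 (T' * V ^ (0 : ℝ))) :=
    ((Real.continuousAt_const_rpow hVpos.ne').tendsto.comp
      (tendsto_pow_atTop_nhds_zero_of_lt_one hθ0.le hθ1)).const_mul _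
  rw [Real.rpow_zero, mul_one] at hlim
  exact le_of_tendsto' hlim hlow

theorem exists_energy {lam : ℝ} (Lam : ℝ) (hlam : 0 < lam) :
    ∃ C > (0 : ℝ), ∀ (n : ℕ) (b : ℝ) (U : Set (Euc n)) (w : Euc n → ℝ)
      (f : Euc n → Euc n), IsLogSol lam Lam b U w f →
      ∀ η : Euc n → ℝ, ContDiff ℝ 1 η → (∀ x, 0 ≤ η x) → HasCompactSupport η →
        tsupport η ⊆ U →
        ∫ x, η x ^ 2 * ‖fderiv ℝ w x‖ ^ 2
          ≤ C * ∫ x, (b ^ 2 * η x ^ 2 + ‖fderiv ℝ η x‖ ^ 2) := by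
  obtain ⟨C, hC, h⟩ := exists_caccioppoli (Lam := Lam) hlam one_pos
  refine ⟨C, hC, fun n b U w f hw η h1 h2 h3 h4 => ?_⟩
  simpa using h n b U w f hw 0 (by norm_num) η h1 h2 h3 h4

/-- A weighted energy bound yields an `L¹` bound of the gradient where the weight is `1`. -/
theorem setIntegral_norm_fderiv_le {n : ℕ} {U S : Set (Euc n)} {w η : Euc n → ℝ} (hU : IsOpen U)
    (hw : ContDiffOn ℝ 1 w U) (hη : Continuous η) (hηc : HasCompactSupport η)
    (hηU : tsupport η ⊆ U) (hS : MeasurableSet S) (hηS : ∀ x ∈ S, η x = 1) :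
    IntegrableOn (fun x => ‖fderiv ℝ w x‖) S ∧ ∫ x in S, ‖fderiv ℝ w x‖
      ≤ volume.real (tsupport η) + ∫ x, η x ^ 2 * ‖fderiv ℝ w x‖ ^ 2 := by
  have hDw : ContinuousOn (fderiv ℝ w) U := hw.continuousOn_fderiv_of_isOpen hU le_rfl
  have hSη : S ⊆ tsupport η := fun x hx => subset_tsupport _ (by simp [hηS x hx])
  have hK : IsCompact (tsupport η) := hηc
  have i1 : Integrable fun x => η x ^ 2 * ‖fderiv ℝ w x‖ ^ 2 :=
    integrable_of_continuousOn_of_eq_zero hU hK hηU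
      (((hη.pow 2).continuousOn).mul (hDw.norm.pow 2))
      fun x hx => by simp [image_eq_zero_of_notMem_tsupport hx]
  have i2 : IntegrableOn (fun x => ‖fderiv ℝ w x‖) S :=
    ((hDw.norm.mono hηU).integrableOn_compact hK).mono_set hSη
  have hfin : volume S ≠ ⊤ := ((measure_mono hSη).trans_lt hK.measure_lt_top).ne
  refine ⟨i2, ?_⟩
  calc ∫ x in S, ‖fderiv ℝ w x‖
      ≤ ∫ x in S, (1 + η x ^ 2 * ‖fderiv ℝ w x‖ ^ 2) := by
        refine setIntegral_mono_on i2 ((integrableOn_const hfin).add i1.integrableOn) hS ?_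
        intro x hx
        rw [hηS x hx]
        nlinarith [sq_nonneg (‖fderiv ℝ w x‖ - 1)]
    _ = volume.real S + ∫ x in S, η x ^ 2 * ‖fderiv ℝ w x‖ ^ 2 := by
        rw [integral_add (integrable_const_iff.2 (Or.inr ⟨by simpa using hfin.lt_top⟩))
          i1.integrableOn, setIntegral_const, smul_eq_mul,
          mul_one]
    _ ≤ _ := by
        refine add_le_add (measureReal_mono hSη hK.measure_lt_top.ne)
          (setIntegral_le_integral i1 (Eventually.of_forall fun x => by positivity))

theorem integral_energy_rhs_le {n : ℕ} {η : Euc n → ℝ} {b L : ℝ} (hη : ContDiff ℝ 1 η)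
    (hη0 : ∀ x, 0 ≤ η x) (hη1 : ∀ x, η x ≤ 1) (hηc : HasCompactSupport η)
    (hDη : ∀ x, ‖fderiv ℝ η x‖ ≤ L) :
    ∫ x, (b ^ 2 * η x ^ 2 + ‖fderiv ℝ η x‖ ^ 2)
      ≤ (b ^ 2 + L ^ 2) * volume.real (tsupport η) := by
  have hK : IsCompact (tsupport η) := hηc
  have h0 : ∀ x ∉ tsupport η, b ^ 2 * η x ^ 2 + ‖fderiv ℝ η x‖ ^ 2 = 0 := fun x hx => by
    have : fderiv ℝ η x = 0 := by
      by_contra h0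
      exact hx (support_fderiv_subset ℝ h0)
    simp [image_eq_zero_of_notMem_tsupport hx, this]
  rw [← setIntegral_eq_integral_of_forall_compl_eq_zero h0, mul_comm, ← smul_eq_mul,
    ← setIntegral_const]
  refine setIntegral_mono_on ?_ (integrableOn_const hK.measure_lt_top.ne)
    (isClosed_tsupport _).measurableSet fun x _ => ?_
  · exact (((continuous_const.mul (hη.continuous.pow 2)).add
      ((hη.continuous_fderiv one_ne_zero).norm.pow 2)).continuousOn).integrableOn_compact hK
  · have a1 : η x ^ 2 ≤ 1 := pow_le_one₀ (hη0 x) (hη1 x)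
    have a2 : ‖fderiv ℝ η x‖ ^ 2 ≤ L ^ 2 := pow_le_pow_left₀ (norm_nonneg _) (hDη x) 2
    nlinarith [sq_nonneg b]

theorem measureReal_ball_center {n : ℕ} (x : Euc n) (r : ℝ) :
    volume.real (ball x r) = volume.real (ball (0 : Euc n) r) := by
  rw [measureReal_def, measureReal_def, Measure.addHaar_ball_center]

theorem measureReal_closedBall_center {n : ℕ} (x : Euc n) (r : ℝ) :
    volume.real (closedBall x r) = volume.real (closedBall (0 : Euc n) r) := by
  rw [measureReal_def, measureReal_def, Measure.addHaar_closedBall_center]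

theorem exists_log_estimate (n : ℕ) {lam : ℝ} (Lam b : ℝ) (hlam : 0 < lam) :
    ∃ C > (0 : ℝ), ∀ (U : Set (Euc n)) (w : Euc n → ℝ) (f : Euc n → Euc n),
      IsLogSol lam Lam b U w f → ∀ x₀ : Euc n, closedBall x₀ 2 ⊆ U →
      ∃ y ∈ ball x₀ 1, ∫ x in ball x₀ 1, |w x - w y| ≤ C := by
  obtain ⟨C₁, hC₁, hen⟩ := exists_energy Lam hlam
  obtain ⟨L, hL, hcut⟩ := exists_cutoff n
  set V := volume.real (closedBall (0 : Euc n) 2)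
  have hV : 0 ≤ V := measureReal_nonneg
  refine ⟨2 * 2 ^ n * (V + C₁ * ((b ^ 2 + L ^ 2) * V)) + 1, by positivity,
    fun U w f hw x₀ hx₀ => ?_⟩
  obtain ⟨η, hη, hη0, hη1, hηs, hηsupp, hDη⟩ := hcut x₀ 1 2 one_pos one_lt_two
  have hη' : ContDiff ℝ 1 η := hη.of_le (by exact_mod_cast le_top)
  have hηU : tsupport η ⊆ U := hηsupp.trans hx₀
  have hηc : HasCompactSupport η :=
    HasCompactSupport.of_support_subset_isCompact (isCompact_closedBall x₀ 2)
      ((subset_tsupport _).trans hηsupp)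
  obtain ⟨y, hy, hpy⟩ := exists_poincare x₀ hw.isOpen hw.contDiffOn
    ((closedBall_subset_closedBall one_le_two).trans hx₀)
  refine ⟨y, hy, hpy.trans ?_⟩
  have h1 := (setIntegral_norm_fderiv_le hw.isOpen hw.contDiffOn hη.continuous hηc hηU
    (measurableSet_ball (x := x₀) (ε := 1)) fun x hx => hηs x (ball_subset_closedBall hx)).2
  have h2 := hen n b U w f hw η hη' hη0 hηc hηU
  have h3 := integral_energy_rhs_le (b := b) (L := L) hη' hη0 hη1 hηc
    fun x => (hDη x).trans (by norm_num)
  have h4 : volume.real (tsupport η) ≤ V := by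
    exact (measureReal_mono hηsupp (isCompact_closedBall x₀ 2).measure_lt_top.ne).trans_eq
      (measureReal_closedBall_center x₀ 2)
  have h5 : ∫ x in ball x₀ 1, ‖fderiv ℝ w x‖ ≤ V + C₁ * ((b ^ 2 + L ^ 2) * V) := by
    refine h1.trans (add_le_add h4 (h2.trans (mul_le_mul_of_nonneg_left (h3.trans ?_) hC₁.le)))
    gcongr
  have h6 : 2 * 2 ^ n * ∫ x in ball x₀ 1, ‖fderiv ℝ w x‖
    ≤ 2 * 2 ^ n * (V + C₁ * ((b ^ 2 + L ^ 2) * V)) := by gcongr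
  linarith

theorem sup_decay {n : ℕ} (hn : 3 ≤ n) {C₀ C₁ Q : ℝ} {x₀ : Euc n} {w : Euc n → ℝ}
    (hC₁ : 0 < C₁) (hQ2 : 2 ≤ Q)
    (hQ : C₁ * 2 ^ n * (volume.real (ball x₀ 1) + 2 * C₀) ≤ Q)
    (hwc : ContinuousOn w (closedBall x₀ 1)) (hL1 : ∫ x in ball x₀ 1, |w x| ≤ C₀)
    (hsup : ∀ (j : ℕ) (s r : ℝ), 0 < s → s < r → r ≤ 1 → ∀ x ∈ ball x₀ s,
      Real.exp ((((n : ℝ) - 2) / n) ^ j * √(((n : ℝ) - 2) / n) * w x) ≤ C₁ / (r - s) ^ n *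
        ∫ x in closedBall x₀ r, Real.exp ((((n : ℝ) - 2) / n) ^ j * √(((n : ℝ) - 2) / n) * w x))
    {σ σ' m : ℝ} (hσ' : 0 < σ') (hσσ' : σ' < σ) (hσ : σ ≤ 1)
    (hm : (Q / (σ - σ') ^ n) ^ 6 ≤ m) (hwm : ∀ x ∈ ball x₀ σ, w x ≤ m) :
    ∀ x ∈ ball x₀ σ', w x ≤ 3 / 4 * m := by
  intro x hx
  have hn' : (3 : ℝ) ≤ n := by exact_mod_cast hn
  have hθ3 : 1 / 3 ≤ ((n : ℝ) - 2) / n := by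
    rw [div_le_div_iff₀ (by norm_num) (by linarith)]
    linarith
  have hθ1 : ((n : ℝ) - 2) / n < 1 := by
    rw [div_lt_one (by linarith)]
    linarith
  set θ : ℝ := ((n : ℝ) - 2) / n
  have hθ0 : 0 < θ := by linarith
  have hs0 : 1 / 2 ≤ √θ := Real.le_sqrt_of_sq_le (by linarith)
  have hs0p : 0 < √θ := by linarith
  set d := σ - σ' with hd
  have hd0 : 0 < d := by linarith
  have hd1 : d ≤ 1 := by linarith
  have hQd : 2 ≤ Q / d ^ n := by
    rw [le_div_iff₀ (by positivity)]
    have : d ^ n ≤ 1 := pow_le_one₀ hd0.le hd1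
    linarith
  have hm64 : 64 ≤ m := by
    refine le_trans ?_ hm
    calc (64 : ℝ) = 2 ^ 6 := by norm_num
      _ ≤ _ := by gcongr
  have hm0 : 0 < m := by linarith
  have hlog0 : 0 < Real.log m := Real.log_pos (by linarith)
  have hlog : Real.log m ≤ m / 4 := by
    have h1 : 8 ≤ √m := Real.le_sqrt_of_sq_le (by linarith)
    have h2 := Real.log_le_sub_one_of_pos (by linarith : 0 < √m)
    rw [Real.log_sqrt hm0.le] at h2
    have h3 := Real.mul_self_sqrt hm0.le
    nlinarith
  obtain ⟨j, hj1, hj2⟩ := exists_nat_pow_near_of_lt_one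
    (x := 2 * Real.log m / (m * √θ)) (y := θ) (by positivity)
    (by
      rw [div_le_one (by positivity)]
      nlinarith) hθ0 hθ1
  rw [lt_div_iff₀ (by positivity)] at hj1
  rw [div_le_iff₀ (by positivity)] at hj2
  set p := θ ^ (j + 1) * √θ with hp
  have hp0 : 0 < p := by positivity
  have hpm : p * m < 2 * Real.log m := by
    rw [hp]
    linarith
  have hpm' : 2 / 3 * Real.log m ≤ p * m := by
    have e : p * m = θ * (θ ^ j * (m * √θ)) := by
      rw [hp]
      ring
    rw [e]
    nlinarith
  set r := (σ + σ') / 2 with hr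
  have hrσ : r < σ := by linarith
  have hsub : closedBall x₀ r ⊆ ball x₀ σ := closedBall_subset_ball hrσ
  have hrd : r - σ' = d / 2 := by
    rw [hr, hd]
    ring
  have hx1 := hsup (j + 1) σ' r hσ' (by linarith) (by linarith) x hx
  rw [hrd] at hx1
  set V := volume.real (ball x₀ 1) with hV
  have hexpm : Real.exp (p * m / 2) ≤ m := by
    rw [← Real.le_log_iff_exp_le hm0]
    linarith
  have hI : ∫ x in closedBall x₀ r, Real.exp (p * w x)
      ≤ Real.exp (p * m / 2) * (V + 2 * C₀) := by
    have habs : IntegrableOn (fun x => |w x|) (ball x₀ 1) :=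
      (hwc.abs.integrableOn_compact (isCompact_closedBall _ _)).mono_set ball_subset_closedBall
    have hc : IntegrableOn (fun _ : Euc n => (1 : ℝ)) (ball x₀ 1) :=
      integrableOn_const measure_ball_lt_top.ne
    have hF : IntegrableOn (fun x => 1 + 2 * |w x|) (ball x₀ 1) := Integrable.add hc
      (Integrable.const_mul habs 2)
    have hsub1 : closedBall x₀ r ⊆ ball x₀ 1 := hsub.trans (ball_subset_ball hσ)
    calc ∫ x in closedBall x₀ r, Real.exp (p * w x)
        ≤ ∫ x in closedBall x₀ r, Real.exp (p * m / 2) * (1 + 2 * |w x|) := by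
          refine setIntegral_mono_on ?_ (Integrable.const_mul (hF.mono_set hsub1) _)
            isClosed_closedBall.measurableSet fun z hz => ?_
          · exact (((continuousOn_const.mul hwc).rexp).integrableOn_compact
              (isCompact_closedBall _ _)).mono_set (hsub1.trans ball_subset_closedBall)
          · rcases le_or_gt (w z) (m / 2) with h | h
            · have h1 : Real.exp (p * w z) ≤ Real.exp (p * m / 2) := by
                apply Real.exp_le_exp.2
                nlinarith
              refine h1.trans (le_mul_of_one_le_right (Real.exp_pos _).le ?_)
              linarith [abs_nonneg (w z)]
            · have h1 : Real.exp (p * w z) ≤ Real.exp (p * m / 2) * Real.exp (p * m / 2) := by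
                rw [← Real.exp_add]
                apply Real.exp_le_exp.2
                nlinarith [hwm z (hsub hz)]
              refine h1.trans (mul_le_mul_of_nonneg_left ?_ (Real.exp_pos _).le)
              linarith [le_abs_self (w z)]
      _ ≤ ∫ x in ball x₀ 1, Real.exp (p * m / 2) * (1 + 2 * |w x|) :=
          setIntegral_mono_set (Integrable.const_mul hF _)
            (Eventually.of_forall fun x => by positivity) (LE.le.eventuallyLE hsub1)
      _ = Real.exp (p * m / 2) * (V + 2 * ∫ x in ball x₀ 1, |w x|) := by
          rw [integral_const_mul, integral_add hc (Integrable.const_mul habs 2),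
            integral_const_mul, setIntegral_const, smul_eq_mul, mul_one]
      _ ≤ _ := by gcongr
  have hx2 : Real.exp (p * w x) ≤ Q / d ^ n * Real.exp (p * m / 2) := by
    calc _ ≤ C₁ / (d / 2) ^ n * (Real.exp (p * m / 2) * (V + 2 * C₀)) :=
          hx1.trans (mul_le_mul_of_nonneg_left hI (by positivity))
      _ = C₁ * 2 ^ n * (V + 2 * C₀) / d ^ n * Real.exp (p * m / 2) := by
          rw [div_pow]
          field_simp
      _ ≤ _ := by gcongr
  have hlogQ : 6 * Real.log (Q / d ^ n) ≤ Real.log m := by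
    have := Real.log_le_log (by positivity) hm
    rwa [Real.log_pow] at this
  have hx3 : p * w x ≤ Real.log (Q / d ^ n) + p * m / 2 := by
    rw [← Real.exp_le_exp, Real.exp_add, Real.exp_log (by linarith)]
    exact hx2
  have hx4 : p * w x ≤ p * (3 / 4 * m) := by linarith
  exact le_of_mul_le_mul_left hx4 hp0

/-- Bombieri–Giusti type lemma: an `L¹` bound and reverse Hölder bounds for small exponents give
an upper bound. -/
theorem exists_upper_bound {n : ℕ} (hn : 3 ≤ n) {C₀ C₁ : ℝ} (hC₁ : 0 < C₁) :
    ∃ C > (0 : ℝ), ∀ (x₀ : Euc n) (w : Euc n → ℝ), ContinuousOn w (closedBall x₀ 1) →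
    ∫ x in ball x₀ 1, |w x| ≤ C₀ →
    (∀ (j : ℕ) (s r : ℝ), 0 < s → s < r → r ≤ 1 → ∀ x ∈ ball x₀ s,
      Real.exp ((((n : ℝ) - 2) / n) ^ j * √(((n : ℝ) - 2) / n) * w x) ≤ C₁ / (r - s) ^ n *
        ∫ x in closedBall x₀ r, Real.exp ((((n : ℝ) - 2) / n) ^ j * √(((n : ℝ) - 2) / n) * w x)) →
    ∀ x ∈ ball x₀ (1 / 2), w x ≤ C := by
  set Q := max 2 (C₁ * 2 ^ n * (volume.real (ball (0 : Euc n) 1) + 2 * C₀)) with hQ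
  have hQ2 : 2 ≤ Q := le_max_left _ _
  set c : ℕ := 6 * n with hc
  have hc1 : (1 : ℝ) ≤ c := by
    have : 1 ≤ c := by omega
    exact_mod_cast this
  set ε : ℝ := 1 / (8 * c) with hε
  have hε0 : 0 < ε := by positivity
  have hεc : c * ε = 1 / 8 := by
    rw [hε]
    field_simp
  have hε1 : ε ≤ 1 / 8 := by nlinarith
  set t : ℝ := 1 - ε with ht
  have ht0 : 0 < t := by linarith
  have htc : 7 / 8 ≤ t ^ c := by
    have := one_add_mul_le_pow (a := -ε) (by linarith) c
    rw [ht, sub_eq_add_neg]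
    linarith
  refine ⟨2 ^ c * (Q ^ 6 * (2 / ε) ^ c), by positivity, fun x₀ w hwc hL1 hsup => ?_⟩
  set h : Euc n → ℝ := fun x => (1 - dist x x₀) ^ c * w x with hh
  have hhc : ContinuousOn h (closedBall x₀ 1) := ContinuousOn.mul (by fun_prop) hwc
  obtain ⟨z, hz, hzmax⟩ := (isCompact_closedBall x₀ (1 : ℝ)).exists_isMaxOn
    ⟨x₀, mem_closedBall_self zero_le_one⟩ hhc
  suffices hz' : h z ≤ Q ^ 6 * (2 / ε) ^ c by
    intro x hx
    have hx' : dist x x₀ < 1 / 2 := hx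
    have h1 : h x ≤ h z := hzmax (closedBall_subset_closedBall (by norm_num)
      (ball_subset_closedBall hx))
    rcases le_or_gt (w x) 0 with h0 | h0
    · exact h0.trans (by positivity)
    · have h2 : (1 / 2) ^ c * w x ≤ h x := by
        simp only [hh]
        gcongr
        linarith
      calc w x = 2 ^ c * ((1 / 2) ^ c * w x) := by
            rw [← mul_assoc, ← mul_pow]
            norm_num
        _ ≤ _ := mul_le_mul_of_nonneg_left (by linarith) (by positivity)
  by_contra! hlt
  have hR0 : 0 < Q ^ 6 * (2 / ε) ^ c := by positivity
  set d := 1 - dist z x₀ with hd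
  have hz1 : dist z x₀ ≤ 1 := hz
  have hzh : h z = d ^ c * w z := rfl
  have hd0 : 0 < d := by
    rcases (by linarith : (0 : ℝ) ≤ d).eq_or_lt with h0 | h0
    · rw [hzh, ← h0, zero_pow (by omega), zero_mul] at hlt
      linarith
    · exact h0
  have hd1 : d ≤ 1 := by
    have := dist_nonneg (x := z) (y := x₀)
    linarith
  have hwz : 0 < w z := by
    by_contra! h0
    have : d ^ c * w z ≤ 0 := mul_nonpos_of_nonneg_of_nonpos (by positivity) h0
    linarith
  set m := w z / t ^ c with hm
  have hσm : ∀ x ∈ ball x₀ (1 - t * d), w x ≤ m := by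
    intro x hx
    have hx' : dist x x₀ < 1 - t * d := hx
    have htd : 0 < t * d := by positivity
    rcases le_or_gt (w x) 0 with h0 | h0
    · exact h0.trans (by positivity)
    have h1 : h x ≤ h z := hzmax (show dist x x₀ ≤ 1 by linarith)
    have h2 : (t * d) ^ c * w x ≤ h x := by
      simp only [hh]
      gcongr
      linarith
    have h3 := h2.trans h1
    rw [hzh, mul_pow] at h3
    rw [hm, le_div_iff₀ (by positivity)]
    have : 0 < d ^ c := by positivity
    refine le_of_mul_le_mul_left (a := d ^ c) ?_ this
    linarith
  have hdiff : (1 - t * d) - (1 - (t + 1) / 2 * d) = ε * d / 2 := by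
    rw [ht]
    ring
  have hbig : (Q / ((1 - t * d) - (1 - (t + 1) / 2 * d)) ^ n) ^ 6 ≤ m := by
    rw [hdiff, hm, le_div_iff₀ (by positivity)]
    have e1 : (Q / (ε * d / 2) ^ n) ^ 6 = Q ^ 6 * (2 / ε) ^ c / d ^ c := by
      have e2 : ((ε * d / 2) ^ n) ^ 6 = ε ^ c * d ^ c / 2 ^ c := by
        rw [← pow_mul, hc, mul_comm n 6, div_pow, mul_pow]
      rw [div_pow, e2, div_pow 2 ε]
      field_simp
    have ht1 : t ^ c ≤ 1 := pow_le_one₀ ht0.le (by linarith)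
    rw [e1]
    calc _ ≤ Q ^ 6 * (2 / ε) ^ c / d ^ c := mul_le_of_le_one_right (by positivity) ht1
      _ ≤ w z := by
          rw [div_le_iff₀ (by positivity)]
          linarith
  have hVQ : C₁ * 2 ^ n * (volume.real (ball x₀ 1) + 2 * C₀) ≤ Q := by
    rw [measureReal_ball_center x₀ 1]
    exact le_max_right _ _
  have htd1 : (t + 1) / 2 * d < 1 := by nlinarith
  have hfin := sup_decay hn hC₁ hQ2 hVQ hwc hL1 hsup (by linarith)
    (by nlinarith) (by nlinarith) hbig hσm z (show dist z x₀ < _ by nlinarith)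
  rw [hm, mul_div_assoc', le_div_iff₀ (by positivity)] at hfin
  nlinarith

/-- Interior Harnack inequality on unit scale. -/
theorem exists_harnack {n : ℕ} (hn : 3 ≤ n) {lam : ℝ} (Lam b : ℝ) (hlam : 0 < lam) :
    ∃ H > (0 : ℝ), ∀ (U : Set (Euc n)) (w : Euc n → ℝ) (f : Euc n → Euc n),
      IsLogSol lam Lam b U w f → ∀ x₀ : Euc n, closedBall x₀ 2 ⊆ U →
      ∀ x ∈ ball x₀ (1 / 2), ∀ x' ∈ ball x₀ (1 / 2), w x - w x' ≤ H := by
  obtain ⟨C₀, hC₀, hlog⟩ := exists_log_estimate n Lam b hlam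
  have hn' : (3 : ℝ) ≤ n := by exact_mod_cast hn
  have hθ0 : 0 < ((n : ℝ) - 2) / n := div_pos (by linarith) (by linarith)
  have hθ1 : ((n : ℝ) - 2) / n < 1 := by
    rw [div_lt_one (by linarith)]
    linarith
  set θ : ℝ := ((n : ℝ) - 2) / n with hθ
  have hs0 : 0 < √θ := Real.sqrt_pos.2 hθ0
  have hs1 : √θ < 1 := (Real.sqrt_lt' one_pos).2 (by simpa using hθ1)
  have hss : √θ * √θ = θ := Real.mul_self_sqrt hθ0.le
  obtain ⟨C₁, hC₁, hsup⟩ := exists_sup_estimate hn Lam b hlam (by linarith : 0 < 1 - √θ)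
  obtain ⟨C, hC, hup⟩ := exists_upper_bound (C₀ := C₀) hn hC₁
  refine ⟨2 * C, by positivity, fun U w f hw x₀ hx₀ => ?_⟩
  have hx₁ : closedBall x₀ 1 ⊆ U := (closedBall_subset_closedBall one_le_two).trans hx₀
  obtain ⟨y, hy, hL1⟩ := hlog U w f hw x₀ hx₀
  have hv := hw.sub_const (w y)
  have hvc : ContinuousOn (fun x => w x - w y) (closedBall x₀ 1) := hv.contDiffOn.continuousOn.mono hx₁
  have hple : ∀ j : ℕ, θ ^ j * √θ ≤ 1 := fun j =>
    mul_le_one₀ (pow_le_one₀ hθ0.le hθ1.le) hs0.le hs1.le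
  have hgap : ∀ j k : ℕ, 1 - √θ ≤ |θ ^ j * √θ / θ ^ k - 1| := by
    intro j k
    rcases le_or_gt k j with h | h
    · have e : θ ^ j * √θ / θ ^ k = θ ^ (j - k) * √θ := by
        rw [pow_sub₀ _ hθ0.ne' h]
        ring
      have : θ ^ (j - k) * √θ ≤ √θ := mul_le_of_le_one_left hs0.le (pow_le_one₀ hθ0.le hθ1.le)
      rw [e, abs_sub_comm]
      exact le_trans (by linarith) (le_abs_self _)
    · refine le_trans ?_ (le_abs_self _)
      have h1 : θ ^ k ≤ θ ^ (j + 1) := pow_le_pow_of_le_one hθ0.le hθ1.le h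
      have h2 : 2 - √θ ≤ θ ^ j * √θ / θ ^ k := by
        rw [le_div_iff₀ (by positivity)]
        calc (2 - √θ) * θ ^ k ≤ (2 - √θ) * θ ^ (j + 1) := by
              gcongr
              linarith
          _ = θ ^ j * √θ * ((2 - √θ) * √θ) := by
              rw [pow_succ]
              linear_combination (-(2 - √θ) * θ ^ j) * hss
          _ ≤ θ ^ j * √θ * 1 := by
              gcongr
              nlinarith
          _ = _ := mul_one _
      linarith
  have hup1 := hup x₀ _ hvc hL1 fun j s r hs hsr hr x hx =>
    hsup U _ f hv x₀ hx₁ (θ ^ j * √θ) (by rw [abs_of_pos (by positivity)]; exact hple j)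
      (hgap j) s r hs hsr hr x hx
  have hup2 := hup x₀ (fun x => -(w x - w y)) hvc.neg (by simpa only [abs_neg] using hL1)
    fun j s r hs hsr hr x hx => by
      have := hsup U _ f hv x₀ hx₁ (-(θ ^ j * √θ))
        (by rw [abs_neg, abs_of_pos (by positivity)]; exact hple j)
        (fun k => by
          have h1 : 0 < θ ^ j * √θ / θ ^ k := by positivity
          rw [neg_div, abs_of_neg (by linarith)]
          linarith) s r hs hsr hr x hx
      simpa only [neg_mul, mul_neg] using this
  intro x hx x' hx'
  have h1 := hup1 x hx
  have h2 := hup2 x' hx'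
  linarith

theorem exists_harnack_chain {n : ℕ} (hn : 3 ≤ n) {lam : ℝ} (Lam b : ℝ) (hlam : 0 < lam) :
    ∃ H > (0 : ℝ), ∀ (U : Set (Euc n)) (w : Euc n → ℝ) (f : Euc n → Euc n),
      IsLogSol lam Lam b U w f → ∀ (N : ℕ) (a c : Euc n), ‖c - a‖ < N / 2 →
      (∀ t ∈ Icc (0 : ℝ) 1, closedBall (a + t • (c - a)) 2 ⊆ U) → w a - w c ≤ N * H := by
  obtain ⟨H, hH, hhar⟩ := exists_harnack hn Lam b hlam
  refine ⟨H, hH, fun U w f hw N a c hN hseg => ?_⟩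
  have hN0 : (0 : ℝ) < N := by linarith [norm_nonneg (c - a)]
  set x : ℕ → Euc n := fun i => a + ((i : ℝ) / N) • (c - a) with hx
  have hstep : ∀ i < N, w (x i) - w (x (i + 1)) ≤ H := by
    intro i hi
    have hi' : (i : ℝ) ≤ N := by exact_mod_cast hi.le
    refine hhar U w f hw (x i) (hseg _ ⟨by positivity, (div_le_one hN0).2 hi'⟩) _
      (mem_ball_self (by norm_num)) _ ?_
    have e : x (i + 1) - x i = (1 / (N : ℝ)) • (c - a) := by
      simp only [hx]
      push_cast
      module
    rw [mem_ball, dist_eq_norm, e, norm_smul, Real.norm_of_nonneg (by positivity), div_mul_eq_mul_div,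
      div_lt_iff₀ hN0]
    linarith
  have hsum : ∀ i ≤ N, w (x 0) - w (x i) ≤ i * H := by
    intro i
    induction i with
    | zero => simp
    | succ k ih =>
      intro hk
      have h1 := ih (by omega)
      have h2 := hstep k (by omega)
      push_cast
      linarith
  have h := hsum N le_rfl
  have e0 : x 0 = a := by simp [hx]
  have e1 : x N = c := by simp [hx, div_self hN0.ne']
  rwa [e0, e1] at h

theorem closedBall_subset_annulus {n : ℕ} {a c : Euc n} (ha : 4 ≤ ‖a‖) (ha' : ‖a‖ ≤ 8)
    (hc : 4 ≤ ‖c‖) (hc' : ‖c‖ ≤ 8) (hac : ⟪a, c⟫ = 0) {t : ℝ} (ht : t ∈ Icc (0 : ℝ) 1) :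
    closedBall (a + t • (c - a)) 2 ⊆ {x : Euc n | 0 < ‖x‖ ∧ ‖x‖ < 12} := by
  obtain ⟨ht0, ht1⟩ := ht
  have e : a + t • (c - a) = (1 - t) • a + t • c := by module
  have hup : ‖a + t • (c - a)‖ ≤ 8 := by
    rw [e]
    refine (norm_add_le _ _).trans ?_
    rw [norm_smul, norm_smul, Real.norm_of_nonneg ht0, Real.norm_of_nonneg (by linarith)]
    nlinarith
  have hlow : 2 < ‖a + t • (c - a)‖ := by
    have h1 : ‖a + t • (c - a)‖ ^ 2 = (1 - t) ^ 2 * ‖a‖ ^ 2 + t ^ 2 * ‖c‖ ^ 2 := by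
      rw [e, norm_add_sq_real, norm_smul, norm_smul, inner_smul_left, inner_smul_right, hac,
        mul_pow, mul_pow, Real.norm_eq_abs, Real.norm_eq_abs, sq_abs, sq_abs]
      ring
    have h2 : 16 ≤ ‖a‖ ^ 2 := by nlinarith
    have h3 : 16 ≤ ‖c‖ ^ 2 := by nlinarith
    have h4 : (1 - t) ^ 2 * 16 ≤ (1 - t) ^ 2 * ‖a‖ ^ 2 := by gcongr
    have h5 : t ^ 2 * 16 ≤ t ^ 2 * ‖c‖ ^ 2 := by gcongr
    refine lt_of_pow_lt_pow_left₀ 2 (norm_nonneg _) ?_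
    nlinarith [sq_nonneg (2 * t - 1)]
  intro x hx
  rw [mem_closedBall, dist_eq_norm] at hx
  have h1 := norm_sub_norm_le (a + t • (c - a)) x
  have h2 := norm_sub_norm_le x (a + t • (c - a))
  rw [norm_sub_rev] at h1
  exact ⟨by linarith, by linarith⟩

theorem exists_orthogonal {n : ℕ} (hn : 3 ≤ n) (a c : Euc n) :
    ∃ v : Euc n, ‖v‖ = 4 ∧ ⟪a, v⟫ = 0 ∧ ⟪v, c⟫ = 0 := by
  set T : Euc n →ₗ[ℝ] ℝ × ℝ :=
    ((innerSL ℝ a : Euc n →L[ℝ] ℝ) : Euc n →ₗ[ℝ] ℝ).prod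
      ((innerSL ℝ c : Euc n →L[ℝ] ℝ) : Euc n →ₗ[ℝ] ℝ) with hT
  have hker : LinearMap.ker T ≠ ⊥ := by
    refine LinearMap.ker_ne_bot_of_finrank_lt ?_
    simp
    omega
  obtain ⟨u, hu, hu0⟩ := Submodule.exists_mem_ne_zero_of_ne_bot hker
  rw [LinearMap.mem_ker] at hu
  have h1 : ⟪a, u⟫ = 0 := by simpa [hT] using congrArg Prod.fst hu
  have h2 : ⟪c, u⟫ = 0 := by simpa [hT] using congrArg Prod.snd hu
  have hun : ‖u‖ ≠ 0 := norm_ne_zero_iff.2 hu0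
  refine ⟨(4 / ‖u‖) • u, ?_, ?_, ?_⟩
  · rw [norm_smul, Real.norm_of_nonneg (by positivity)]
    field_simp
  · rw [inner_smul_right, h1, mul_zero]
  · rw [inner_smul_left, real_inner_comm, h2, mul_zero]

theorem isOpen_annulus (n : ℕ) : IsOpen {x : Euc n | 0 < ‖x‖ ∧ ‖x‖ < 12} :=
  (isOpen_lt continuous_const continuous_norm).inter (isOpen_lt continuous_norm continuous_const)

theorem exists_annulus_harnack {n : ℕ} (hn : 3 ≤ n) {lam : ℝ} (Lam b : ℝ) (hlam : 0 < lam) :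
    ∃ H > (0 : ℝ), ∀ (w : Euc n → ℝ) (f : Euc n → Euc n),
      IsLogSol lam Lam b {x | 0 < ‖x‖ ∧ ‖x‖ < 12} w f → ∀ a c : Euc n, 4 ≤ ‖a‖ → ‖a‖ ≤ 8 →
      4 ≤ ‖c‖ → ‖c‖ ≤ 8 → w a - w c ≤ H := by
  obtain ⟨H, hH, hch⟩ := exists_harnack_chain hn Lam b hlam
  refine ⟨66 * H, by positivity, fun w f hw a c ha ha' hc hc' => ?_⟩
  obtain ⟨v, hv, hav, hvc⟩ := exists_orthogonal hn a c
  have h1 := hch _ w f hw 33 a v ((norm_sub_le _ _).trans_lt (by norm_num; linarith))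
    fun t ht => closedBall_subset_annulus ha ha' hv.ge (by linarith) hav ht
  have h2 := hch _ w f hw 33 v c ((norm_sub_le _ _).trans_lt (by norm_num; linarith))
    fun t ht => closedBall_subset_annulus hv.ge (by linarith) hc hc' hvc ht
  norm_num at h1 h2
  linarith

theorem exists_annular_cutoff (n : ℕ) : ∃ η : Euc n → ℝ, ContDiff ℝ 1 η ∧ (∀ x, 0 ≤ η x) ∧
    (∀ x, η x ≤ 1) ∧ HasCompactSupport η ∧ tsupport η ⊆ {x | 0 < ‖x‖ ∧ ‖x‖ < 12} ∧
    ∀ x ∈ closedBall (0 : Euc n) 7 \ ball 0 5, η x = 1 := by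
  obtain ⟨L, -, hcut⟩ := exists_cutoff n
  obtain ⟨φ, hφ, hφ0, hφ1, hφs, hφsupp, -⟩ := hcut 0 7 8 (by norm_num) (by norm_num)
  obtain ⟨χ, hχ, hχ0, hχ1, hχs, hχsupp, -⟩ := hcut 0 3 4 (by norm_num) (by norm_num)
  have hout : ∀ (r : ℝ) (g : Euc n → ℝ), tsupport g ⊆ closedBall 0 r → ∀ x, r < ‖x‖ → g x = 0 :=
    fun r g hg x hx => image_eq_zero_of_notMem_tsupport fun h => by
      have := hg h
      rw [mem_closedBall_zero_iff] at this
      linarith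
  have hsub : tsupport (fun x => φ x * (1 - χ x)) ⊆ {x : Euc n | 3 ≤ ‖x‖ ∧ ‖x‖ ≤ 8} := by
    refine closure_minimal (fun x hx => ?_) ((isClosed_le continuous_const continuous_norm).inter
      (isClosed_le continuous_norm continuous_const))
    by_contra h
    refine hx ?_
    rw [mem_ofPred_eq, not_and_or, not_le, not_le] at h
    rcases h with h | h
    · simp [hχs x (mem_closedBall_zero_iff.2 h.le)]
    · simp [hout 8 φ hφsupp x h]
  refine ⟨fun x => φ x * (1 - χ x), ?_, fun x => mul_nonneg (hφ0 x) (by linarith [hχ1 x]),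
    fun x => mul_le_one₀ (hφ1 x) (by linarith [hχ1 x]) (by linarith [hχ0 x]), ?_,
    hsub.trans fun x hx => ⟨by linarith [hx.1], by linarith [hx.2]⟩, fun x hx => ?_⟩
  · exact (hφ.mul (contDiff_const.sub hχ)).of_le (by exact_mod_cast le_top)
  · exact HasCompactSupport.of_support_subset_isCompact (isCompact_closedBall (0 : Euc n) 8)
      fun x hx => mem_closedBall_zero_iff.2 (hsub (subset_tsupport _ hx)).2
  · have h5 : 5 ≤ ‖x‖ := by simpa using hx.2
    simp [hφs x hx.1, hout 4 χ hχsupp x (by linarith)]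

/-- The flux of a solution through an annulus is controlled by its value at an outer point. -/
theorem exists_flux_bound {n : ℕ} (hn : 3 ≤ n) {lam Lam b : ℝ} (hlam : 0 < lam) (hLam : 0 ≤ Lam)
    (hb : 0 ≤ b) :
    ∃ φ : Euc n → ℝ, ContDiff ℝ (⊤ : ℕ∞) φ ∧ (∀ x ∈ ball (0 : Euc n) 5, φ x = 1) ∧
      tsupport φ ⊆ closedBall 0 7 ∧
      ∃ C > (0 : ℝ), ∀ (w : Euc n → ℝ) (f : Euc n → Euc n),
        IsLogSol lam Lam b {x | 0 < ‖x‖ ∧ ‖x‖ < 12} w f → ∀ z : Euc n, ‖z‖ = 8 →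
        ∫ x, fderiv ℝ φ x (Real.exp (w x) • f x) ≤ C * Real.exp (w z) := by
  obtain ⟨L, hL, hcut⟩ := exists_cutoff n
  obtain ⟨φ, hφ, -, -, hφs, hφsupp, hDφ⟩ := hcut 0 5 7 (by norm_num) (by norm_num)
  obtain ⟨η, hη, hη0, hη1, hηc, hηU, hηS⟩ := exists_annular_cutoff n
  obtain ⟨H, -, hhar⟩ := exists_annulus_harnack hn Lam b hlam
  obtain ⟨C₁, hC₁, hen⟩ := exists_energy Lam hlam
  refine ⟨φ, hφ, fun x hx => hφs x (ball_subset_closedBall hx), hφsupp, ?_⟩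
  set S := closedBall (0 : Euc n) 7 \ ball 0 5 with hS
  set I := ∫ x, (b ^ 2 * η x ^ 2 + ‖fderiv ℝ η x‖ ^ 2) with hI
  have hI0 : 0 ≤ I := integral_nonneg fun x => by positivity
  have hSm : MeasurableSet S := measurableSet_closedBall.diff measurableSet_ball
  have hSfin : volume S ≠ ⊤ := ((measure_mono sdiff_subset).trans_lt measure_closedBall_lt_top).ne
  have hφ_out : ∀ x ∉ S, fderiv ℝ φ x = 0 := by
    intro x hx
    by_cases h7 : x ∈ closedBall (0 : Euc n) 7
    · have h5 : x ∈ ball (0 : Euc n) 5 := by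
        by_contra h
        exact hx ⟨h7, h⟩
      have : φ =ᶠ[𝓝 x] fun _ => 1 := by
        filter_upwards [isOpen_ball.mem_nhds h5] with z hz using hφs z (ball_subset_closedBall hz)
      rw [this.fderiv_eq, fderiv_fun_const, Pi.zero_apply]
    · by_contra h0
      exact h7 (hφsupp (support_fderiv_subset ℝ h0))
  have hV : 0 ≤ volume.real (tsupport η) := measureReal_nonneg
  have hVS : 0 ≤ volume.real S := measureReal_nonneg
  refine ⟨L / 2 * Real.exp H * (Lam * (volume.real (tsupport η) + C₁ * I) + volume.real S * b + 1),
    by positivity, fun w f hw z hz => ?_⟩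
  obtain ⟨hint, hle⟩ := setIntegral_norm_fderiv_le hw.isOpen hw.contDiffOn hη.continuous hηc hηU
    hSm hηS
  have hen' := hen n b _ w f hw η hη hη0 hηc hηU
  set K := L / 2 * Real.exp H * Real.exp (w z) with hK
  have hK0 : 0 ≤ K := by positivity
  have hcb : IntegrableOn (fun _ : Euc n => b) S := integrableOn_const hSfin
  have hbd : IntegrableOn (fun x => K * (Lam * ‖fderiv ℝ w x‖ + b)) S :=
    Integrable.const_mul (Integrable.add (Integrable.const_mul hint Lam) hcb) K
  have hpt : ∀ x, ‖fderiv ℝ φ x (Real.exp (w x) • f x)‖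
      ≤ S.indicator (fun x => K * (Lam * ‖fderiv ℝ w x‖ + b)) x := by
    intro x
    by_cases hx : x ∈ S
    · rw [indicator_of_mem hx]
      have h7 : ‖x‖ ≤ 7 := mem_closedBall_zero_iff.1 hx.1
      have h5 : 5 ≤ ‖x‖ := by simpa using hx.2
      have h1 : Real.exp (w x) ≤ Real.exp H * Real.exp (w z) := by
        rw [← Real.exp_add, Real.exp_le_exp]
        linarith [hhar w f hw x z (by linarith) (by linarith) (by linarith) (by linarith)]
      have h2 : ‖fderiv ℝ φ x‖ ≤ L / 2 := (hDφ x).trans (by norm_num)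
      have h3 := hw.bound x ⟨by linarith, by linarith⟩
      refine (ContinuousLinearMap.le_opNorm _ _).trans ?_
      rw [norm_smul, Real.norm_of_nonneg (Real.exp_pos _).le, hK]
      calc _ ≤ L / 2 * (Real.exp H * Real.exp (w z) * (Lam * ‖fderiv ℝ w x‖ + b)) := by gcongr
        _ = _ := by ring
    · rw [indicator_of_notMem hx, hφ_out x hx]
      simp
  have h1 := norm_integral_le_of_norm_le (hbd.integrable_indicator hSm) (Eventually.of_forall hpt)
  rw [integral_indicator hSm, integral_const_mul,
    integral_add (Integrable.const_mul hint Lam) hcb, integral_const_mul, setIntegral_const,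
    smul_eq_mul] at h1
  refine (le_abs_self _).trans (h1.trans ?_)
  have h2 : ∫ x in S, ‖fderiv ℝ w x‖ ≤ volume.real (tsupport η) + C₁ * I := by linarith
  calc K * ((Lam * ∫ x in S, ‖fderiv ℝ w x‖) + volume.real S * b)
      ≤ K * (Lam * (volume.real (tsupport η) + C₁ * I)) + K * (volume.real S * b) + K * 1 := by
        have : K * (Lam * ∫ x in S, ‖fderiv ℝ w x‖)
          ≤ K * (Lam * (volume.real (tsupport η) + C₁ * I)) := by gcongr
        linarith
    _ = _ := by
        rw [hK]
        ring

/-- If the divergence of `F` is a nonzero multiple of a Dirac mass, then the test integrals are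
genuine integrals. -/
theorem integrable_fderiv_of_integral_eq {n : ℕ} {F : Euc n → Euc n} {c : ℝ} (hc : c ≠ 0)
    (hF : ∀ φ : Euc n → ℝ, ContDiff ℝ (⊤ : ℕ∞) φ → HasCompactSupport φ →
      tsupport φ ⊆ closedBall 0 13 → ∫ x, fderiv ℝ φ x (F x) = c * φ 0)
    {φ : Euc n → ℝ} (hφ : ContDiff ℝ (⊤ : ℕ∞) φ) (hφ' : tsupport φ ⊆ closedBall 0 13) :
    Integrable (fun x => fderiv ℝ φ x (F x)) := by
  have hcs : ∀ {φ : Euc n → ℝ}, tsupport φ ⊆ closedBall 0 13 → HasCompactSupport φ := fun h =>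
    HasCompactSupport.of_support_subset_isCompact (isCompact_closedBall 0 13)
      ((subset_tsupport _).trans h)
  have h1 : ∀ {φ : Euc n → ℝ}, ContDiff ℝ (⊤ : ℕ∞) φ → tsupport φ ⊆ closedBall 0 13 →
      φ 0 ≠ 0 → Integrable (fun x => fderiv ℝ φ x (F x)) := by
    intro φ hφ hφ' h0
    by_contra hni
    have := hF φ hφ (hcs hφ') hφ'
    rw [integral_undef hni] at this
    exact mul_ne_zero hc h0 this.symm
  obtain ⟨L, -, hL⟩ := exists_cutoff n
  obtain ⟨η, hη, -, -, hη1, hηs, -⟩ := hL 0 12 13 (by norm_num) (by norm_num)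
  have hη0 : η 0 = 1 := hη1 0 (by simp)
  have hη' : Integrable (fun x => fderiv ℝ η x (F x)) := h1 hη hηs (by simp [hη0])
  have hψ : ContDiff ℝ (⊤ : ℕ∞) (fun x => φ x + (1 - φ 0) * η x) :=
    hφ.add (contDiff_const.mul hη)
  have hψs : tsupport (fun x => φ x + (1 - φ 0) * η x) ⊆ closedBall 0 13 := by
    refine closure_minimal ?_ isClosed_closedBall
    intro x hx
    by_contra hx'
    refine hx ?_
    simp [image_eq_zero_of_notMem_tsupport fun h => hx' (hφ' h),
      image_eq_zero_of_notMem_tsupport fun h => hx' (hηs h)]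
  have h2 := (h1 hψ hψs (by simp [hη0])).sub (hη'.const_mul (1 - φ 0))
  refine h2.congr (Eventually.of_forall fun x => ?_)
  have e : fderiv ℝ (fun x => φ x + (1 - φ 0) * η x) x =
      fderiv ℝ φ x + (1 - φ 0) • fderiv ℝ η x := by
    have d1 : DifferentiableAt ℝ φ x := hφ.differentiable (by simp) x
    have d2 : DifferentiableAt ℝ η x := hη.differentiable (by simp) x
    rw [fderiv_fun_add d1 (d2.const_mul _), fderiv_const_mul d2]
  simp [e]

theorem integrableOn_flux {n : ℕ} {F : Euc n → Euc n} {c : ℝ} (hc : c ≠ 0)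
    (hF : ∀ φ : Euc n → ℝ, ContDiff ℝ (⊤ : ℕ∞) φ → HasCompactSupport φ →
      tsupport φ ⊆ closedBall 0 13 → ∫ x, fderiv ℝ φ x (F x) = c * φ 0) :
    IntegrableOn F (ball 0 12) := by
  obtain ⟨L, -, hL⟩ := exists_cutoff n
  obtain ⟨η, hη, -, -, hη1, hηs, -⟩ := hL 0 12 13 (by norm_num) (by norm_num)
  refine Integrable.of_eval_piLp fun i => ?_
  have hφ : ContDiff ℝ (⊤ : ℕ∞) (fun x : Euc n => x i * η x) :=
    ((EuclideanSpace.proj (𝕜 := ℝ) i).contDiff).mul hη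
  have hφs : tsupport (fun x : Euc n => x i * η x) ⊆ closedBall 0 13 := by
    refine closure_minimal ?_ isClosed_closedBall
    intro x hx
    by_contra hx'
    refine hx ?_
    simp [image_eq_zero_of_notMem_tsupport fun h => hx' (hηs h)]
  refine (integrable_fderiv_of_integral_eq hc hF hφ hφs).integrableOn.congr_fun ?_
    measurableSet_ball
  intro x hx
  have e : (fun x : Euc n => x i * η x) =ᶠ[𝓝 x] EuclideanSpace.proj (𝕜 := ℝ) i := by
    filter_upwards [isOpen_ball.mem_nhds hx] with z hz
    simp [hη1 z (ball_subset_closedBall hz)]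
  simp only [e.fderiv_eq, ContinuousLinearMap.fderiv]
  rfl

/-- The log-transform of a positive `C¹` function on a punctured ball whose flux has a
nonzero multiple of a Dirac mass as divergence. -/
theorem isLogSol_log {n : ℕ} {lam Lam b c : ℝ} {u : Euc n → ℝ} {F : Euc n → Euc n} (hc : c ≠ 0)
    (hF : ∀ φ : Euc n → ℝ, ContDiff ℝ (⊤ : ℕ∞) φ → HasCompactSupport φ →
      tsupport φ ⊆ closedBall 0 13 → ∫ x, fderiv ℝ φ x (F x) = c * φ 0)
    (hu : ContDiffOn ℝ 1 u {x | 0 < ‖x‖ ∧ ‖x‖ < 12})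
    (hpos : ∀ x, 0 < ‖x‖ → ‖x‖ < 12 → 0 < u x)
    (hco : ∀ x, 0 < ‖x‖ → ‖x‖ < 12 →
      lam * ‖fderiv ℝ u x‖ ^ 2 - b * u x * ‖fderiv ℝ u x‖ ≤ fderiv ℝ u x (F x))
    (hbd : ∀ x, 0 < ‖x‖ → ‖x‖ < 12 → ‖F x‖ ≤ Lam * ‖fderiv ℝ u x‖ + b * u x) :
    IsLogSol lam Lam b {x | 0 < ‖x‖ ∧ ‖x‖ < 12} (fun x => Real.log (u x))
      (fun x => (u x)⁻¹ • F x) := by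
  set W : Set (Euc n) := {x | 0 < ‖x‖ ∧ ‖x‖ < 12} with hW
  have hWo : IsOpen W := isOpen_annulus n
  have hWb : W ⊆ ball 0 12 := fun x hx => by simpa using hx.2
  have h0W : (0 : Euc n) ∉ W := fun h => by simpa using h.1
  have hFW : IntegrableOn F (ball 0 12) := integrableOn_flux hc hF
  have hud : ∀ x ∈ W, DifferentiableAt ℝ u x := fun x hx =>
    (hu.contDiffAt (hWo.mem_nhds hx)).differentiableAt one_ne_zero
  have hfd : ∀ x ∈ W, fderiv ℝ (fun x => Real.log (u x)) x = (u x)⁻¹ • fderiv ℝ u x :=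
    fun x hx => fderiv.log (hud x hx) (hpos x hx.1 hx.2).ne'
  have hweak0 : ∀ ψ : Euc n → ℝ, ContDiff ℝ 1 ψ → HasCompactSupport ψ → tsupport ψ ⊆ W →
      ∫ x, fderiv ℝ ψ x (F x) = 0 := by
    intro ψ h1 h2 h3
    refine integral_fderiv_eq_zero_of_smooth hWo (fun K hK _ => hFW.mono_set (hK.trans hWb)) ?_
      h1 h2 h3
    intro φ hφ hφc hφs
    rw [hF φ hφ hφc (hφs.trans (hWb.trans (ball_subset_closedBall.trans
      (closedBall_subset_closedBall (by norm_num))))),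
      image_eq_zero_of_notMem_tsupport (fun h => h0W (hφs h)), mul_zero]
  refine ⟨hWo, hu.log fun x hx => (hpos x hx.1 hx.2).ne', ?_, ?_, ?_, ?_⟩
  · have hi : ContinuousOn (fun x => (u x)⁻¹) W :=
      hu.continuousOn.inv₀ fun x hx => (hpos x hx.1 hx.2).ne'
    exact (hi.aestronglyMeasurable hWo.measurableSet).smul
      (hFW.aestronglyMeasurable.mono_measure (Measure.restrict_mono hWb le_rfl))
  · intro x hx
    have hp := hpos x hx.1 hx.2
    have h := mul_le_mul_of_nonneg_left (hco x hx.1 hx.2) (sq_nonneg (u x)⁻¹)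
    rw [hfd x hx, norm_smul, norm_inv, Real.norm_of_nonneg hp.le]
    simp only [smul_apply, map_smul, smul_eq_mul]
    calc _ = (u x)⁻¹ ^ 2 * (lam * ‖fderiv ℝ u x‖ ^ 2 - b * u x * ‖fderiv ℝ u x‖) := by
          field_simp
      _ ≤ _ := h
      _ = _ := by ring
  · intro x hx
    have hp := hpos x hx.1 hx.2
    have h := mul_le_mul_of_nonneg_left (hbd x hx.1 hx.2) (inv_pos.2 hp).le
    rw [hfd x hx, norm_smul, norm_smul, norm_inv, Real.norm_of_nonneg hp.le]
    refine h.trans (le_of_eq ?_)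
    field_simp
  · intro ψ h1 h2 h3
    have hs : tsupport (fun x => ψ x * (u x)⁻¹) ⊆ tsupport ψ := tsupport_mul_subset_left
    have hC : ContDiff ℝ 1 (fun x => ψ x * (u x)⁻¹) :=
      contDiff_of_tsupport_subset hWo
        (h1.contDiffOn.mul (hu.inv fun x hx => (hpos x hx.1 hx.2).ne')) (hs.trans h3)
    rw [← hweak0 _ hC (h2.mul_right) (hs.trans h3)]
    refine integral_congr_ae (Eventually.of_forall fun x => ?_)
    simp only
    by_cases hx : x ∈ W
    · have hp := hpos x hx.1 hx.2
      have d1 : DifferentiableAt ℝ ψ x := h1.differentiable one_ne_zero x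
      have d2 := (hasDerivAt_inv hp.ne').comp_hasFDerivAt x (hud x hx).hasFDerivAt
      have d3 : fderiv ℝ (fun x => ψ x * (u x)⁻¹) x =
          ψ x • (-(u x ^ 2)⁻¹ • fderiv ℝ u x) + (u x)⁻¹ • fderiv ℝ ψ x :=
        (d1.hasFDerivAt.mul d2).fderiv
      rw [hfd x hx, d3]
      simp only [add_apply, smul_apply, map_smul, smul_eq_mul]
      field_simp
      ring
    · have hn : x ∉ tsupport ψ := fun h => hx (h3 h)
      have e1 : fderiv ℝ ψ x = 0 := by
        by_contra h0
        exact hn (support_fderiv_subset ℝ h0)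
      have e2 : fderiv ℝ (fun x => ψ x * (u x)⁻¹) x = 0 := by
        by_contra h0
        exact hn (hs (support_fderiv_subset ℝ h0))
      simp [e1, e2, image_eq_zero_of_notMem_tsupport hn]

theorem norm_adjoint_le {n : ℕ} {Lam : ℝ} {T : Euc n →L[ℝ] Euc n}
    (h : ∀ η ψ : Euc n, |⟪T η, ψ⟫| ≤ Lam * ‖η‖ * ‖ψ‖) (v : Euc n) :
    ‖ContinuousLinearMap.adjoint T v‖ ≤ Lam * ‖v‖ := by
  set w := ContinuousLinearMap.adjoint T v with hw
  rcases eq_or_ne w 0 with h0 | h0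
  · have h1 := h v v
    rcases eq_or_ne v 0 with hv | hv
    · simp [h0, hv]
    · have : 0 ≤ Lam * ‖v‖ :=
        nonneg_of_mul_nonneg_left ((abs_nonneg _).trans h1) (norm_pos_iff.2 hv)
      simpa [h0] using this
  · have h1 := h w v
    have h2 : ⟪T w, v⟫ = ‖w‖ ^ 2 := by
      rw [← ContinuousLinearMap.adjoint_inner_right, ← hw, real_inner_self_eq_norm_sq]
    rw [h2, abs_of_nonneg (sq_nonneg _)] at h1
    have h3 : 0 < ‖w‖ := norm_pos_iff.2 h0
    refine le_of_mul_le_mul_left ?_ h3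
    nlinarith

theorem integral_fderiv_comp_smul_add {n : ℕ} {F : Euc n → Euc n} {y : Euc n} {s : ℝ} (hs : 0 < s)
    (hy : closedBall y (13 * s) ⊆ ball 0 1)
    (h : ∀ φ : Euc n → ℝ, ContDiff ℝ (⊤ : ℕ∞) φ → HasCompactSupport φ → tsupport φ ⊆ ball 0 1 →
      ∫ x in ball (0 : Euc n) 1, fderiv ℝ φ x (F x) = φ y)
    {φ : Euc n → ℝ} (hφ : ContDiff ℝ (⊤ : ℕ∞) φ) (hφs : tsupport φ ⊆ closedBall 0 13) :
    ∫ x, fderiv ℝ φ x (s • F (y + s • x)) = s ^ 2 / s ^ n * φ 0 := by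
  set Φ : Euc n → ℝ := fun X => φ (s⁻¹ • (X - y)) with hΦ
  have hΦc : ContDiff ℝ (⊤ : ℕ∞) Φ := hφ.comp ((contDiff_id.sub contDiff_const).const_smul _)
  have hΦs : tsupport Φ ⊆ closedBall y (13 * s) := by
    refine closure_minimal ?_ isClosed_closedBall
    intro X hX
    have h1 := hφs (subset_tsupport _ hX)
    rw [mem_closedBall_zero_iff, norm_smul, norm_inv, Real.norm_of_nonneg hs.le,
      inv_mul_le_iff₀ hs] at h1
    rw [mem_closedBall, dist_eq_norm]
    linarith
  have hΦy := h Φ hΦc (HasCompactSupport.of_support_subset_isCompact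
    (isCompact_closedBall y (13 * s)) ((subset_tsupport _).trans hΦs)) (hΦs.trans hy)
  rw [setIntegral_eq_integral_of_forall_compl_eq_zero] at hΦy
  swap
  · intro x hx
    have : fderiv ℝ Φ x = 0 := by
      by_contra h0
      exact hx (hy (hΦs (support_fderiv_subset ℝ h0)))
    simp [this]
  set g : Euc n → ℝ := fun X => fderiv ℝ Φ X (F X) with hg
  have hpt : ∀ x, fderiv ℝ φ x (s • F (y + s • x)) = s ^ 2 * g (y + s • x) := by
    intro x
    have e : s⁻¹ • (y + s • x - y) = x := by
      rw [add_sub_cancel_left, smul_smul, inv_mul_cancel₀ hs.ne', one_smul]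
    have d1 : HasFDerivAt φ (fderiv ℝ φ x) (s⁻¹ • (y + s • x - y)) := by
      rw [e]
      exact (hφ.differentiable (by simp) x).hasFDerivAt
    have d2 : HasFDerivAt (fun X : Euc n => s⁻¹ • (X - y))
        (s⁻¹ • ContinuousLinearMap.id ℝ (Euc n)) (y + s • x) :=
      ((hasFDerivAt_id _).sub_const y).const_smul s⁻¹
    have d3 : fderiv ℝ Φ (y + s • x) = (fderiv ℝ φ x).comp
        (s⁻¹ • ContinuousLinearMap.id ℝ (Euc n)) :=
      (HasFDerivAt.comp (y + s • x) (f := fun X : Euc n => s⁻¹ • (X - y)) d1 d2).fderiv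
    simp only [hg, d3, ContinuousLinearMap.comp_apply, smul_apply,
      ContinuousLinearMap.id_apply, map_smul, smul_eq_mul]
    field_simp
  simp only [hpt]
  rw [integral_const_mul, Measure.integral_comp_smul volume (fun x => g (y + x)) s,
    integral_add_left_eq_self g y, hΦy, abs_of_nonneg (by positivity)]
  simp [hΦ, div_eq_mul_inv]
  ring

theorem drift_scaled_le {n : ℕ} {β M s : ℝ} {B : Euc n → Euc n} (hβ : 0 < β) (hB : DriftBound β M B)
    {x : Euc n} (hs : 0 < s) (hx : s ≤ 1 - ‖x‖) : s * ‖B x‖ ≤ M := by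
  have ht : 0 < 1 - ‖x‖ := hs.trans_le hx
  refine le_trans ?_ (hB x (by simpa using ht))
  refine mul_le_mul_of_nonneg_right (hx.trans ?_) (norm_nonneg _)
  calc 1 - ‖x‖ = (1 - ‖x‖) ^ (1 : ℝ) := (Real.rpow_one _).symm
    _ ≤ (1 - ‖x‖) ^ (1 - β) := by
      refine Real.rpow_le_rpow_of_exponent_ge ht ?_ (by linarith)
      linarith [norm_nonneg x]

theorem inner_gradient_eq {n : ℕ} (φ : Euc n → ℝ) (x v : Euc n) :
    ⟪gradient φ x, v⟫ = fderiv ℝ φ x v := by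
  rw [← toDual_gradient, InnerProductSpace.toDual_apply_apply]

theorem norm_gradient_eq {n : ℕ} (φ : Euc n → ℝ) (x : Euc n) :
    ‖gradient φ x‖ = ‖fderiv ℝ φ x‖ := by
  rw [← toDual_gradient, LinearIsometryEquiv.norm_map]

/-- The flux `Aᵀ∇u - uB` of the equation satisfied by `u`. -/
def flux {n : ℕ} (A : Euc n → Euc n →L[ℝ] Euc n) (B : Euc n → Euc n) (u : Euc n → ℝ)
    (x : Euc n) : Euc n :=
  ContinuousLinearMap.adjoint (A x) (gradient u x) - u x • B x

theorem fderiv_flux {n : ℕ} (A : Euc n → Euc n →L[ℝ] Euc n) (B : Euc n → Euc n) (u φ : Euc n → ℝ)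
    (x : Euc n) : fderiv ℝ φ x (flux A B u x) =
      ⟪A x (gradient φ x), gradient u x⟫ - u x * ⟪B x, gradient φ x⟫ := by
  rw [← inner_gradient_eq, flux, inner_sub_right, inner_smul_right,
    ContinuousLinearMap.adjoint_inner_right, real_inner_comm (B x)]

theorem norm_flux_le {n : ℕ} {lam Lam : ℝ} {A : Euc n → Euc n →L[ℝ] Euc n} {B : Euc n → Euc n}
    {u : Euc n → ℝ} {x : Euc n} (hA : IsElliptic lam Lam A) (hx : x ∈ ball (0 : Euc n) 1)
    (hu : 0 ≤ u x) : ‖flux A B u x‖ ≤ Lam * ‖fderiv ℝ u x‖ + u x * ‖B x‖ := by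
  refine (norm_sub_le _ _).trans (add_le_add ?_ ?_)
  · rw [← norm_gradient_eq]
    exact norm_adjoint_le (hA x hx).2 _
  · rw [norm_smul, Real.norm_of_nonneg hu]

theorem le_fderiv_flux {n : ℕ} {lam Lam : ℝ} {A : Euc n → Euc n →L[ℝ] Euc n} {B : Euc n → Euc n}
    {u : Euc n → ℝ} {x : Euc n} (hA : IsElliptic lam Lam A) (hx : x ∈ ball (0 : Euc n) 1)
    (hu : 0 ≤ u x) :
    lam * ‖fderiv ℝ u x‖ ^ 2 - u x * (‖B x‖ * ‖fderiv ℝ u x‖) ≤ fderiv ℝ u x (flux A B u x) := by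
  rw [fderiv_flux, ← norm_gradient_eq]
  exact sub_le_sub ((hA x hx).1 _) (mul_le_mul_of_nonneg_left (real_inner_le_norm _ _) hu)

/-- The blow-up of a Green's function at its pole is the exponential of a log-solution. -/
theorem IsGreenFn.isLogSol {n : ℕ} {β M lam Lam s : ℝ} {A : Euc n → Euc n →L[ℝ] Euc n}
    {B : Euc n → Euc n} {G : Euc n → Euc n → ℝ} (hG : IsGreenFn A B G) (hβ : 0 < β)
    (hA : IsElliptic lam Lam A) (hB : DriftBound β M B) {y : Euc n} (hs : 0 < s)
    (hsy : 16 * s ≤ 1 - ‖y‖) :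
    (∀ φ : Euc n → ℝ, ContDiff ℝ (⊤ : ℕ∞) φ → tsupport φ ⊆ closedBall 0 13 →
      ∫ x, fderiv ℝ φ x (s • flux A B (G y) (y + s • x)) = s ^ 2 / s ^ n * φ 0) ∧
    (∀ x, 0 < ‖x‖ → ‖x‖ < 12 → 0 < G y (y + s • x)) ∧
    IsLogSol lam Lam M {x | 0 < ‖x‖ ∧ ‖x‖ < 12} (fun x => Real.log (G y (y + s • x)))
      (fun x => (G y (y + s • x))⁻¹ • s • flux A B (G y) (y + s • x)) := by
  obtain ⟨hpos, hC, -, -, hw⟩ := hG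
  have hy : y ∈ ball (0 : Euc n) 1 := by
    rw [mem_ball_zero_iff]
    linarith
  have hint : ∀ φ : Euc n → ℝ, ContDiff ℝ (⊤ : ℕ∞) φ → tsupport φ ⊆ closedBall 0 13 →
      ∫ x, fderiv ℝ φ x (s • flux A B (G y) (y + s • x)) = s ^ 2 / s ^ n * φ 0 := by
    intro φ hφ hφs
    refine integral_fderiv_comp_smul_add hs ?_ ?_ hφ hφs
    · refine closedBall_subset_ball' ?_
      rw [dist_zero_right]
      linarith
    · intro φ h1 h2 h3
      rw [← hw y hy φ h1 h2 h3]
      simp only [fderiv_flux]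
  have hT : ∀ x : Euc n, ‖x‖ < 12 → s ≤ 1 - ‖y + s • x‖ := by
    intro x hx
    have := norm_add_le y (s • x)
    rw [norm_smul, Real.norm_of_nonneg hs.le] at this
    nlinarith
  have hTb : ∀ x : Euc n, ‖x‖ < 12 → y + s • x ∈ ball (0 : Euc n) 1 := by
    intro x hx
    rw [mem_ball_zero_iff]
    linarith [hT x hx]
  have hTy : ∀ x : Euc n, 0 < ‖x‖ → y + s • x ≠ y := by
    intro x hx h
    rw [add_eq_left, smul_eq_zero] at h
    rcases h with h | h
    · exact hs.ne' h
    · simp [h] at hx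
  have hposT : ∀ x, 0 < ‖x‖ → ‖x‖ < 12 → 0 < G y (y + s • x) := fun x h0 h12 =>
    hpos y hy _ (hTb x h12) (hTy x h0)
  have hfd : ∀ x, 0 < ‖x‖ → ‖x‖ < 12 →
      fderiv ℝ (fun x => G y (y + s • x)) x = s • fderiv ℝ (G y) (y + s • x) := by
    intro x h0 h12
    have d1 : HasFDerivAt (G y) (fderiv ℝ (G y) (y + s • x)) (y + s • x) :=
      (((hC y hy).contDiffAt ((isOpen_ball.sdiff isClosed_singleton).mem_nhds
        ⟨hTb x h12, hTy x h0⟩)).differentiableAt one_ne_zero).hasFDerivAt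
    have d2 : HasFDerivAt (fun x : Euc n => y + s • x) (s • ContinuousLinearMap.id ℝ (Euc n)) x :=
      ((hasFDerivAt_id x).const_smul s).const_add y
    refine (d1.comp x d2).fderiv.trans ?_
    ext v
    simp
  refine ⟨hint, hposT, isLogSol_log (u := fun x => G y (y + s • x))
    (F := fun x => s • flux A B (G y) (y + s • x)) (c := s ^ 2 / s ^ n) (by positivity)
    (fun φ h1 _ h3 => hint φ h1 h3) ?_ hposT ?_ ?_⟩
  · refine (hC y hy).comp (contDiff_const.add (contDiff_id.const_smul s)).contDiffOn ?_
    exact fun x hx => ⟨hTb x hx.2, hTy x hx.1⟩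
  · intro x h0 h12
    have hp := hposT x h0 h12
    have h1 := le_fderiv_flux (B := B) hA (hTb x h12) hp.le
    have h2 := drift_scaled_le hβ hB hs (hT x h12)
    rw [hfd x h0 h12, norm_smul, Real.norm_of_nonneg hs.le]
    simp only [smul_apply, map_smul, smul_eq_mul]
    set D := ‖fderiv ℝ (G y) (y + s • x)‖
    have h3 := mul_le_mul_of_nonneg_left h1 (sq_nonneg s)
    have h4 : G y (y + s • x) * (s * D) * (s * ‖B (y + s • x)‖) ≤
        G y (y + s • x) * (s * D) * M :=
      mul_le_mul_of_nonneg_left h2 (by positivity)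
    linarith
  · intro x h0 h12
    have hp := hposT x h0 h12
    have h1 := norm_flux_le (B := B) hA (hTb x h12) hp.le
    have h2 := drift_scaled_le hβ hB hs (hT x h12)
    rw [hfd x h0 h12, norm_smul, norm_smul, Real.norm_of_nonneg hs.le]
    have h3 := mul_le_mul_of_nonneg_left h1 hs.le
    have h4 := mul_le_mul_of_nonneg_left h2 hp.le
    linarith

/-- pointwise lower bound `G(y,z) ≥ K |z-y|^{2-n}` for `|z-y| ≤ δ(y)/2`, for
a Green's function of `L₁ = -div(A∇·) + B·∇` with `(λ,Λ)`-elliptic `A` and drift bounded by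
`δ(x)^{1-β}|B(x)| ≤ M`; the constant `K` depends only on `n`, `λ`, `Λ`, `M`, `β`. -/
theorem green_lower_bound
    (n : ℕ) (hn : 3 ≤ n) (β M lam Lam : ℝ)
    (hβ0 : 0 < β) (hβ1 : β < 1) (hM : 0 < M) (hlam : 0 < lam) (hLam : lam ≤ Lam) :
    ∃ K > (0 : ℝ), ∀ (A : Euc n → Euc n →L[ℝ] Euc n) (B : Euc n → Euc n)
      (G : Euc n → Euc n → ℝ),
      IsElliptic lam Lam A → Measurable B → DriftBound β M B → IsGreenFn A B G →
      ∀ y ∈ ball (0 : Euc n) 1, ∀ z ∈ ball (0 : Euc n) 1, z ≠ y →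
        ‖z - y‖ ≤ (1 - ‖y‖) / 2 →
        G y z ≥ K * ‖z - y‖ ^ ((2 : ℝ) - n) := by
  obtain ⟨φ, hφ, hφ1, hφs, C, hC, hflux⟩ :=
    exists_flux_bound hn hlam (hlam.le.trans hLam) hM.le
  refine ⟨1 / C, by positivity, ?_⟩
  intro A B G hA _ hB hG y _ z _ hzy hr
  set r := ‖z - y‖ with hrdef
  have hr0 : 0 < r := norm_pos_iff.2 (sub_ne_zero.2 hzy)
  set s := r / 8 with hsdef
  have hs : 0 < s := by positivity
  obtain ⟨hint, hpos, hsol⟩ := hG.isLogSol hβ0 hA hB hs (by linarith : 16 * s ≤ 1 - ‖y‖)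
  have hz8 : ‖s⁻¹ • (z - y)‖ = 8 := by
    rw [norm_smul, norm_inv, Real.norm_of_nonneg hs.le, ← hrdef, hsdef]
    field_simp
  have hzT : y + s • s⁻¹ • (z - y) = z := by
    rw [smul_smul, mul_inv_cancel₀ hs.ne', one_smul, add_sub_cancel]
  have h := hflux _ _ hsol _ hz8
  have hGz : 0 < G y z := by
    have := hpos _ (by rw [hz8]; norm_num) (by rw [hz8]; norm_num : ‖s⁻¹ • (z - y)‖ < 12)
    rwa [hzT] at this
  simp only [hzT, Real.exp_log hGz] at h
  have hleft : ∫ x, fderiv ℝ φ x (Real.exp (Real.log (G y (y + s • x))) •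
      (G y (y + s • x))⁻¹ • s • flux A B (G y) (y + s • x)) = s ^ 2 / s ^ n := by
    have h1 := hint φ hφ (hφs.trans (closedBall_subset_closedBall (by norm_num)))
    rw [hφ1 0 (by simp), mul_one] at h1
    rw [← h1]
    refine integral_congr_ae (Eventually.of_forall fun x => ?_)
    simp only
    by_cases h0 : 0 < ‖x‖
    · by_cases h12 : ‖x‖ < 12
      · have hp := hpos x h0 h12
        rw [Real.exp_log hp, smul_smul, mul_inv_cancel₀ hp.ne', one_smul]
      · have : fderiv ℝ φ x = 0 := by
          by_contra hne
          have := hφs (support_fderiv_subset ℝ hne)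
          rw [mem_closedBall_zero_iff] at this
          linarith
        simp [this]
    · have hx : x = 0 := by simpa using h0
      have e : φ =ᶠ[𝓝 x] fun _ => 1 := by
        filter_upwards [isOpen_ball.mem_nhds (by simp [hx] : x ∈ ball (0 : Euc n) 5)] with v hv
        exact hφ1 v hv
      simp [e.fderiv_eq]
  rw [hleft] at h
  have hpow : r ^ ((2 : ℝ) - n) ≤ s ^ 2 / s ^ n := by
    have e : s ^ 2 / s ^ n = s ^ ((2 : ℝ) - n) := by
      rw [Real.rpow_sub hs, Real.rpow_natCast, Real.rpow_ofNat]
    rw [e]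
    have hn' : (3 : ℝ) ≤ n := by exact_mod_cast hn
    exact Real.rpow_le_rpow_of_nonpos hs (by linarith) (by linarith)
  rw [ge_iff_le, one_div, inv_mul_le_iff₀ hC]
  exact hpow.trans h
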